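/- Let k be an algebraically closed field of characteristic p > 0. Let F ∈ k[X,Y,Z] be a homogeneous polynomial of degree 3 such that the only common zero in k³ of F and its three partial derivatives ∂F/∂X, ∂F/∂Y, ∂F/∂Z is (0,0,0) (so that C = V₊(F) ⊂ ℙ² is a smooth plane cubic, i.e. an elliptic curve). Set R = k[X,Y,Z]/(F). Then the Hilbert–Kunz multiplicity of the irrelevant maximal ideal m = (X,Y,Z) exists and equals 9/4; that is, lim_{e→∞} dim_k( k[X,Y,Z]/(F, X^{p^e}, Y^{p^e}, Z^{p^e}) ) / p^{2e} = 9/4. -/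

import Mathlib

open MvPolynomial Filter

universe u

section PolynomialRing

variable {k : Type*} [Field k]

attribute [local instance] MvPolynomial.gradedAlgebra in
theorem homogeneousComponent_mul_of_isHomogeneous {σ : Type*} {d : ℕ} {F : MvPolynomial σ k}
    (hF : F.IsHomogeneous d) (n : ℕ) (G : MvPolynomial σ k) :
    homogeneousComponent (d + n) (F * G) = F * homogeneousComponent n G := by
  have := DirectSum.coe_decompose_mul_add_of_left_mem (homogeneousSubmodule σ k) (i := d) (j := n)
    (b := G) hF
  erw [decomposition.decompose'_apply, decomposition.decompose'_apply] at this
  exact this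

attribute [local instance] MvPolynomial.gradedAlgebra in
theorem homogeneousComponent_mul_eq_zero_of_lt {σ : Type*} {d n : ℕ} {F : MvPolynomial σ k}
    (hF : F.IsHomogeneous d) (hn : n < d) (G : MvPolynomial σ k) :
    homogeneousComponent n (F * G) = 0 := by
  have := DirectSum.coe_decompose_mul_of_left_mem_of_not_le (homogeneousSubmodule σ k) (i := d)
    (b := G) hF (not_le.2 hn)
  erw [decomposition.decompose'_apply] at this
  exact this

theorem natDegree_coeff_aeval_of_isHomogeneous {d n : ℕ} {G : MvPolynomial (Fin 3) k}
    (hG : G.IsHomogeneous d) (P : Fin 3 → Polynomial k) (hP : ∀ i, (P i).natDegree ≤ n) :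
    (aeval P G).natDegree ≤ d * n ∧
      (aeval P G).coeff (d * n) = eval (fun i => (P i).coeff n) G := by
  have key : ∀ m ∈ G.support, (∏ i, P i ^ m i).natDegree ≤ d * n ∧
      (∏ i, P i ^ m i).coeff (d * n) = ∏ i, (P i).coeff n ^ m i := by
    intro m hm
    have hd : d = m 0 + m 1 + m 2 := by
      have := hG (mem_support_iff.1 hm)
      rw [← this, Finsupp.weight_apply, Finsupp.sum_fintype _ _ (by simp), Fin.sum_univ_three]
      simp
    have h1 : ∀ i, (P i ^ m i).natDegree ≤ m i * n := fun i =>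
      Polynomial.natDegree_pow_le_of_le _ (hP i)
    have h2 : ∀ i, (P i ^ m i).coeff (m i * n) = (P i).coeff n ^ m i := fun i => by
      rw [Polynomial.coeff_pow_of_natDegree_le (hP i)]
    have h3 : (P 0 ^ m 0 * P 1 ^ m 1).natDegree ≤ m 0 * n + m 1 * n :=
      Polynomial.natDegree_mul_le_of_le (h1 0) (h1 1)
    rw [Fin.prod_univ_three, Fin.prod_univ_three, hd, add_mul, add_mul]
    refine ⟨Polynomial.natDegree_mul_le_of_le h3 (h1 2), ?_⟩
    rw [Polynomial.coeff_mul_add_eq_of_natDegree_le h3 (h1 2),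
      Polynomial.coeff_mul_add_eq_of_natDegree_le (h1 0) (h1 1), h2, h2, h2]
  rw [aeval_def, eval₂_eq', eval_eq']
  constructor
  · refine Polynomial.natDegree_sum_le_of_forall_le _ _ fun m hm => ?_
    rw [Polynomial.algebraMap_eq]
    exact (Polynomial.natDegree_C_mul_le _ _).trans (key m hm).1
  · rw [Polynomial.finsetSum_coeff]
    refine Finset.sum_congr rfl fun m hm => ?_
    rw [Polynomial.algebraMap_eq, Polynomial.coeff_C_mul, (key m hm).2]

theorem exists_common_zero_of_isHomogeneous_one_two [IsAlgClosed k] {l Q : MvPolynomial (Fin 3) k}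
    (hl : l.IsHomogeneous 1) (hQ : Q.IsHomogeneous 2) :
    ∃ a : Fin 3 → k, a ≠ 0 ∧ eval a l = 0 ∧ eval a Q = 0 := by
  let φ : (Fin 3 → k) →ₗ[k] k :=
    ∑ i, (coeff 0 (pderiv i l)) • LinearMap.proj i
  have hφ : ∀ a, eval a l = φ a := by
    intro a
    have h := congrArg (eval a) hl.sum_X_mul_pderiv
    have hc : ∀ i, pderiv i l = C (coeff 0 (pderiv i l)) := fun i =>
      totalDegree_eq_zero_iff_eq_C.1 (Nat.le_zero.1 (hl.pderiv (i := i)).totalDegree_le)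
    rw [one_smul, map_sum] at h
    rw [← h]
    simp only [φ, LinearMap.sum_apply, LinearMap.smul_apply, LinearMap.proj_apply, smul_eq_mul]
    refine Finset.sum_congr rfl fun i _ => ?_
    rw [map_mul, eval_X, hc i, eval_C, coeff_C, if_pos rfl, mul_comm]
  have hrank : 1 < Module.finrank k (LinearMap.ker φ) := by
    have h1 := LinearMap.finrank_range_add_finrank_ker φ
    have h2 := Submodule.finrank_le (LinearMap.range φ)
    simp only [Module.finrank_fintype_fun_eq_card, Fintype.card_fin, Module.finrank_self] at h1 h2
    omega
  obtain ⟨v, hv⟩ : ∃ v : LinearMap.ker φ, v ≠ 0 := by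
    have : Nontrivial (LinearMap.ker φ) :=
      Module.nontrivial_of_finrank_pos (R := k) (zero_lt_one.trans hrank)
    exact exists_ne 0
  obtain ⟨w, hvw⟩ := exists_linearIndependent_pair_of_one_lt_finrank hrank hv
  have hw : (w : Fin 3 → k) ≠ 0 := by
    have := hvw.ne_zero 1
    simpa using this
  let P : Fin 3 → Polynomial k := fun i =>
    Polynomial.C (w.1 i) * Polynomial.X + Polynomial.C (v.1 i)
  have hP : ∀ i, (P i).natDegree ≤ 1 := fun i => Polynomial.natDegree_linear_le
  obtain ⟨h1, h2⟩ := natDegree_coeff_aeval_of_isHomogeneous hQ P hP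
  have hPw : (fun i => (P i).coeff 1) = w.1 := by ext i; simp [P]
  by_cases hdeg : (aeval P Q).natDegree = 0
  · refine ⟨w.1, hw, by rw [hφ]; exact w.2, ?_⟩
    rw [← hPw, ← h2]
    exact Polynomial.coeff_eq_zero_of_natDegree_lt (by omega)
  · obtain ⟨r, hr⟩ := IsAlgClosed.exists_root (aeval P Q)
      (fun h => hdeg (Polynomial.natDegree_eq_zero_iff_degree_le_zero.2 h.le))
    refine ⟨r • w.1 + v.1, fun h => ?_, ?_, ?_⟩
    · have := LinearIndependent.pair_iff.1 hvw 1 r (by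
        ext i; have := congrFun h i; simp at this ⊢; rw [add_comm]; exact this)
      exact one_ne_zero this.1
    · rw [hφ, map_add, map_smul, LinearMap.mem_ker.1 w.2, LinearMap.mem_ker.1 v.2]; simp
    · have h3 : Polynomial.aeval r (aeval P Q) = 0 := by
        rw [Polynomial.aeval_def, Polynomial.eval₂_eq_eval_map]; simpa using hr
      rw [← AlgHom.comp_apply, comp_aeval, aeval_def] at h3
      rw [← h3, eval_eq', eval₂_eq']
      refine Finset.sum_congr rfl fun m _ => ?_
      congr 1
      refine Finset.prod_congr rfl fun i _ => ?_
      simp only [P, map_add, map_mul, Polynomial.aeval_C, Polynomial.aeval_X, Pi.add_apply,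
        Pi.smul_apply, smul_eq_mul, Algebra.algebraMap_self, RingHom.id_apply, mul_comm r]

/-- `F` is a ternary cubic form whose projective zero locus is smooth. -/
structure IsSmoothCubic (F : MvPolynomial (Fin 3) k) : Prop where
  isHomogeneous : F.IsHomogeneous 3
  eq_zero_of_singular : ∀ a : Fin 3 → k,
    eval a F = 0 → (∀ i : Fin 3, eval a (pderiv i F) = 0) → a = 0

namespace IsSmoothCubic

variable {F : MvPolynomial (Fin 3) k}

theorem ne_zero (hF : IsSmoothCubic F) : F ≠ 0 := by
  rintro rfl
  have := hF.eq_zero_of_singular 1 (by simp) (by simp)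
  exact one_ne_zero (congrFun this 0)

theorem not_eq_mul_of_totalDegree [IsAlgClosed k] (hF : IsSmoothCubic F)
    {G H : MvPolynomial (Fin 3) k}
    (h : F = G * H) (hG : G.totalDegree = 1) (hH : H.totalDegree = 2) : False := by
  have h3 : F = homogeneousComponent 1 G * homogeneousComponent 2 H := by
    have e1 : G = homogeneousComponent 0 G + homogeneousComponent 1 G := by
      conv_lhs => rw [← sum_homogeneousComponent G, hG]
      simp [Finset.sum_range_succ]
    have e2 : homogeneousComponent 3 F = F := by
      rw [homogeneousComponent_of_mem hF.isHomogeneous, if_pos rfl]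
    rw [← e2, h]
    conv_lhs => rw [e1, add_mul, map_add]
    have e3 :=
      homogeneousComponent_mul_of_isHomogeneous (homogeneousComponent_isHomogeneous 0 G) 3 H
    have e4 :=
      homogeneousComponent_mul_of_isHomogeneous (homogeneousComponent_isHomogeneous 1 G) 2 H
    rw [homogeneousComponent_eq_zero 3 H (by omega), mul_zero] at e3
    rw [zero_add] at e3
    rw [e3, zero_add]
    exact e4
  obtain ⟨a, ha, hl, hQ⟩ := exists_common_zero_of_isHomogeneous_one_two
    (homogeneousComponent_isHomogeneous 1 G) (homogeneousComponent_isHomogeneous 2 H)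
  refine ha (hF.eq_zero_of_singular a (by rw [h3, map_mul, hl, zero_mul]) fun i => ?_)
  rw [h3, Derivation.leibniz]
  simp [hl, hQ]

theorem prime [IsAlgClosed k] (hF : IsSmoothCubic F) : Prime F := by
  have hd := hF.isHomogeneous.totalDegree hF.ne_zero
  have hunit : ∀ {G : MvPolynomial (Fin 3) k}, G ≠ 0 → G.totalDegree = 0 → IsUnit G := by
    intro G hG h0
    rw [totalDegree_eq_zero_iff_eq_C.1 h0] at hG ⊢
    exact IsUnit.map C (IsUnit.mk0 _ (fun h => hG (by rw [h, C_0])))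
  refine Irreducible.prime ⟨fun hu => ?_, fun G H h => ?_⟩
  · obtain ⟨G, hG⟩ := hu.exists_right_inv
    have hG0 : G ≠ 0 := by rintro rfl; simp at hG
    have := totalDegree_mul_of_isDomain hF.ne_zero hG0
    rw [hG, totalDegree_one] at this
    omega
  · have hG0 : G ≠ 0 := by rintro rfl; exact hF.ne_zero (by simpa using h)
    have hH0 : H ≠ 0 := by rintro rfl; exact hF.ne_zero (by simpa using h)
    have := totalDegree_mul_of_isDomain hG0 hH0
    rw [← h, hd] at this
    by_cases g0 : G.totalDegree = 0
    · exact Or.inl (hunit hG0 g0)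
    by_cases h0 : H.totalDegree = 0
    · exact Or.inr (hunit hH0 h0)
    exfalso
    by_cases g1 : G.totalDegree = 1
    · exact hF.not_eq_mul_of_totalDegree h g1 (by omega)
    · exact hF.not_eq_mul_of_totalDegree (h.trans (mul_comm _ _)) (by omega) (by omega)

end IsSmoothCubic

theorem exists_eq_cross_of_sum_X_mul_eq_zero {C : Fin 3 → MvPolynomial (Fin 3) k}
    (h : X 0 * C 0 + X 1 * C 1 + X 2 * C 2 = 0) :
    ∃ E : Fin 3 → MvPolynomial (Fin 3) k, C 0 = X 1 * E 2 - X 2 * E 1 ∧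
      C 1 = X 2 * E 0 - X 0 * E 2 ∧ C 2 = X 0 * E 1 - X 1 * E 0 := by
  have hmem : X 2 * C 2 ∈
      Ideal.span (X '' ({0, 1} : Set (Fin 3)) : Set (MvPolynomial (Fin 3) k)) := by
    rw [Set.image_pair, Ideal.mem_span_pair]
    exact ⟨-C 0, -C 1, by linear_combination -h⟩
  have hmem' : C 2 ∈ Ideal.span (X '' ({0, 1} : Set (Fin 3)) : Set (MvPolynomial (Fin 3) k)) := by
    rw [mem_ideal_span_X_image] at hmem ⊢
    intro m hm
    obtain ⟨i, hi, hne⟩ := hmem (Finsupp.single 2 1 + m) (by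
      rw [mem_support_iff, coeff_X_mul]; exact mem_support_iff.1 hm)
    refine ⟨i, hi, ?_⟩
    rcases hi with rfl | rfl <;> simpa using hne
  rw [Set.image_pair, Ideal.mem_span_pair] at hmem'
  obtain ⟨a, b, hab⟩ := hmem'
  have hdvd : (X 0 : MvPolynomial (Fin 3) k) ∣ X 1 * (C 1 + X 2 * b) :=
    ⟨-(C 0 + X 2 * a), by linear_combination h + X 2 * hab⟩
  obtain ⟨e, he⟩ : (X 0 : MvPolynomial (Fin 3) k) ∣ C 1 + X 2 * b := by
    refine ((X_prime (i := 0)).dvd_or_dvd hdvd).resolve_left fun h => ?_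
    rw [X_dvd_X] at h
    exact absurd h (by decide)
  refine ⟨![-b, a, -e], ?_, ?_, ?_⟩
  · apply mul_left_cancel₀ (X_ne_zero (R := k) (0 : Fin 3))
    change X 0 * C 0 = X 0 * (X 1 * (-e) - X 2 * a)
    linear_combination h + X 2 * hab - X 1 * he
  · simp; linear_combination he
  · simp; linear_combination -hab

theorem exists_eq_X_mul_of_cross_eq_zero {H : Fin 3 → MvPolynomial (Fin 3) k}
    (h : ∀ i j, X i * H j = X j * H i) : ∃ v, ∀ i, H i = X i * v := by
  obtain ⟨v, hv⟩ : X 0 ∣ H 0 := by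
    refine ((X_prime (i := 0)).dvd_or_dvd (⟨H 1, (h 0 1).symm⟩ : X 0 ∣ X 1 * H 0)).resolve_left ?_
    intro h
    rw [X_dvd_X] at h
    exact absurd h (by decide)
  refine ⟨v, fun i => mul_left_cancel₀ (X_ne_zero (R := k) (0 : Fin 3)) ?_⟩
  rw [h 0 i, hv]; ring

theorem exists_dvd_sub_X_mul {F : MvPolynomial (Fin 3) k} (hF0 : F ≠ 0)
    {G : Fin 3 → MvPolynomial (Fin 3) k} (h : ∀ i j, F ∣ X i * G j - X j * G i) :
    ∃ v, ∀ i, F ∣ G i - X i * v := by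
  choose C hC using h
  obtain ⟨E, h0, h1, h2⟩ := exists_eq_cross_of_sum_X_mul_eq_zero
    (C := ![C 1 2, C 2 0, C 0 1]) (by
      apply mul_left_cancel₀ hF0
      change F * (X 0 * C 1 2 + X 1 * C 2 0 + X 2 * C 0 1) = F * 0
      linear_combination - X 0 * hC 1 2 - X 1 * hC 2 0 - X 2 * hC 0 1)
  simp at h0 h1 h2
  have key : ∀ i j, X i * (G j - F * E j) = X j * (G i - F * E i) := by
    have h01 : X 0 * (G 1 - F * E 1) = X 1 * (G 0 - F * E 0) := by
      linear_combination hC 0 1 + F * h2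
    have h12 : X 1 * (G 2 - F * E 2) = X 2 * (G 1 - F * E 1) := by
      linear_combination hC 1 2 + F * h0
    have h20 : X 2 * (G 0 - F * E 0) = X 0 * (G 2 - F * E 2) := by
      linear_combination hC 2 0 + F * h1
    intro i j
    fin_cases i <;> fin_cases j <;> first | rfl | assumption | (symm; assumption)
  obtain ⟨v, hv⟩ := exists_eq_X_mul_of_cross_eq_zero (H := fun i => G i - F * E i) key
  exact ⟨v, fun i => ⟨E i, by linear_combination hv i⟩⟩

theorem exists_isHomogeneous_dvd_sub_X_mul {F : MvPolynomial (Fin 3) k} (hF0 : F ≠ 0) {m n : ℕ}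
    (hF : F.IsHomogeneous (m + 1)) {G : Fin 3 → MvPolynomial (Fin 3) k}
    (hG : ∀ i, (G i).IsHomogeneous (n + 1)) (h : ∀ i j, F ∣ X i * G j - X j * G i) :
    ∃ v : MvPolynomial (Fin 3) k, v.IsHomogeneous n ∧ ∀ i, F ∣ G i - X i * v := by
  obtain ⟨v, hv⟩ := exists_dvd_sub_X_mul hF0 h
  refine ⟨homogeneousComponent n v, homogeneousComponent_isHomogeneous _ _, fun i => ?_⟩
  obtain ⟨E, hE⟩ := hv i
  have := congrArg (homogeneousComponent (n + 1)) hE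
  rw [map_sub, homogeneousComponent_of_mem (hG i), if_pos rfl, add_comm n 1,
    homogeneousComponent_mul_of_isHomogeneous (isHomogeneous_X k i), add_comm 1 n] at this
  rw [this]
  by_cases hmn : m + 1 ≤ n + 1
  · obtain ⟨j, hj⟩ := Nat.exists_eq_add_of_le hmn
    rw [hj, homogeneousComponent_mul_of_isHomogeneous hF]
    exact dvd_mul_right _ _
  · rw [homogeneousComponent_mul_eq_zero_of_lt hF (not_le.1 hmn)]
    exact dvd_zero _

theorem finrank_homogeneousSubmodule (n : ℕ) :
    Module.finrank k (homogeneousSubmodule (Fin 3) k n) = (n + 2).choose 2 := by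
  have hs : ((Finset.univ : Finset (Fin 3)).finsuppAntidiag n : Set (Fin 3 →₀ ℕ)) =
      {d | d.degree = n} := by
    ext d
    simp [Finsupp.degree_eq_sum]
  rw [homogeneousSubmodule_eq_finsupp_supported, ← hs]
  rw [(AddMonoidAlgebra.supportedEquivFinsupp (R := k) (S := k) _).finrank_eq,
    Module.finrank_finsupp_self, ← Nat.card_eq_fintype_card, Nat.card_coe_set_eq,
    Set.ncard_coe_finset,
    Finset.card_finsuppAntidiag_nat_eq_choose, Finset.card_univ, Fintype.card_fin,
    show 3 + n - 1 = n + 2 by omega, ← Nat.choose_symm_add]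

end PolynomialRing

open scoped TensorProduct KaehlerDifferential in
theorem exists_derivation_extending {R S T : Type*} [CommRing R] [CommRing S] [CommRing T]
    [Algebra R S] [Algebra R T] [Algebra S T] [IsScalarTower R S T] (M : Submonoid S)
    [IsLocalization M T] (d : Derivation R S T) :
    ∃ D : Derivation R T T, ∀ s, D (algebraMap S T s) = d s := by
  have : Algebra.FormallyEtale S T := .of_isLocalization M
  let l : T ⊗[S] Ω[S⁄R] →ₗ[T] T := LinearMap.liftBaseChange T d.liftKaehlerDifferential
  let e := KaehlerDifferential.tensorKaehlerEquivOfFormallyEtale R S T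
  refine ⟨(l ∘ₗ e.symm.toLinearMap).compDer (KaehlerDifferential.D R T), fun s => ?_⟩
  have h := KaehlerDifferential.tensorKaehlerEquivOfFormallyEtale_symm_D_algebraMap R S T s
  change l (e.symm (KaehlerDifferential.D R T (algebraMap S T s))) = d s
  rw [h]
  simp [l]

theorem exists_field_derivation_of_algHom {k S L : Type u} [Field k] [CommRing S] [Algebra k S]
    [Field L] [Algebra k L] (φ : S →ₐ[k] L) (d : Derivation k S S)
    (hd : ∀ s, φ s = 0 → φ (d s) = 0) :
    ∃ (K : Type u) (_ : Field K) (_ : Algebra k K) (ψ : S →ₐ[k] K) (δ : Derivation k K K),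
      (∀ s, ψ s = 0 ↔ φ s = 0) ∧ (∀ u, ∃ a b, ψ b ≠ 0 ∧ u * ψ b = ψ a) ∧
      ∀ s, δ (ψ s) = ψ (d s) := by
  let A := S ⧸ RingHom.ker φ
  have hp : (RingHom.ker φ).IsPrime := RingHom.ker_isPrime φ
  let π : S →ₐ[k] A := Ideal.Quotient.mkₐ k (RingHom.ker φ)
  have hπ : Function.Surjective π := Ideal.Quotient.mkₐ_surjective k _
  have hπ0 : ∀ s, π s = 0 ↔ φ s = 0 := fun s =>
    Ideal.Quotient.eq_zero_iff_mem.trans RingHom.mem_ker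
  have hdπ : ∀ s, π s = 0 → π (d s) = 0 := fun s hs => (hπ0 _).2 (hd s ((hπ0 s).1 hs))
  let ι : A →ₐ[k] FractionRing A := IsScalarTower.toAlgHom k A (FractionRing A)
  obtain ⟨δ, hδ⟩ := exists_derivation_extending (R := k) (S := A) (T := FractionRing A)
    (nonZeroDivisors A) (LinearMap.compDer (Algebra.linearMap A (FractionRing A))
      (Derivation.liftOfSurjective hπ hdπ))
  refine ⟨FractionRing A, inferInstance, inferInstance, ι.comp π, δ, fun s => ?_, fun u => ?_,
    fun s => ?_⟩
  · rw [← hπ0]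
    exact map_eq_zero_iff ι (IsFractionRing.injective A (FractionRing A))
  · obtain ⟨⟨a, b⟩, h⟩ := IsLocalization.surj (nonZeroDivisors A) u
    obtain ⟨a', rfl⟩ := hπ a
    obtain ⟨b', hb'⟩ := hπ b
    refine ⟨a', b', ?_, ?_⟩
    · change algebraMap A (FractionRing A) (π b') ≠ 0
      rw [hb']
      exact IsFractionRing.to_map_ne_zero_of_mem_nonZeroDivisors b.2
    · change u * algebraMap A (FractionRing A) (π b') = _
      rw [hb', h]
      rfl
  · refine (hδ (π s)).trans ?_
    change algebraMap A (FractionRing A) (Derivation.liftOfSurjective hπ hdπ (π s)) = _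
    rw [Derivation.liftOfSurjective_apply]
    rfl

section PolynomialRing

variable {k : Type*} [Field k]

/-- A model of the function field of the plane curve `F = 0` in which the coordinate `x 0` is
normalized to `1`, with its invariant derivation. -/
structure FunctionFieldModel (F : MvPolynomial (Fin 3) k) (K : Type*) [Field K] [Algebra k K] where
  x : Fin 3 → K
  x_zero : x 0 = 1
  aeval_eq_zero_iff : ∀ {n : ℕ} {G : MvPolynomial (Fin 3) k}, G.IsHomogeneous n →
    (aeval x G = 0 ↔ F ∣ G)
  exists_fraction : ∀ u : K, ∃ G H : MvPolynomial (Fin 3) k, aeval x H ≠ 0 ∧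
    u * aeval x H = aeval x G
  δ : Derivation k K K
  δ_one : δ (x 1) = aeval x (pderiv 2 F)
  δ_two : δ (x 2) = -aeval x (pderiv 1 F)

theorem aeval_smul_of_isHomogeneous {A : Type*} [CommRing A] [Algebra k A] {n : ℕ}
    {G : MvPolynomial (Fin 3) k} (hG : G.IsHomogeneous n) (c : A) (x : Fin 3 → A) :
    aeval (fun i => c * x i) G = c ^ n * aeval x G := by
  rw [aeval_def, aeval_def, eval₂_eq', eval₂_eq', Finset.mul_sum]
  refine Finset.sum_congr rfl fun m hm => ?_
  have hd : n = ∑ i, m i := by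
    have := hG (mem_support_iff.1 hm)
    rw [← this, Finsupp.weight_apply, Finsupp.sum_fintype _ _ (by simp)]
    simp
  simp_rw [mul_pow, Finset.prod_mul_distrib, Finset.prod_pow_eq_pow_sum, ← hd]
  ring

theorem exists_isHomogeneous_dvd_sub (i : Fin 3) (G : MvPolynomial (Fin 3) k) :
    ∃ (n : ℕ) (G' : MvPolynomial (Fin 3) k), G'.IsHomogeneous n ∧ (X i - 1) ∣ G' - G := by
  refine ⟨G.totalDegree, ∑ j ∈ Finset.range (G.totalDegree + 1),
    X i ^ (G.totalDegree - j) * homogeneousComponent j G, ?_, ?_⟩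
  · refine IsHomogeneous.sum _ _ _ fun j hj => ?_
    have := ((isHomogeneous_X k i).pow (G.totalDegree - j)).mul
      (homogeneousComponent_isHomogeneous j G)
    rwa [one_mul, Nat.sub_add_cancel (Nat.lt_succ_iff.1 (Finset.mem_range.1 hj))] at this
  · conv_rhs => rhs; rw [← sum_homogeneousComponent G]
    rw [← Finset.sum_sub_distrib]
    refine Finset.dvd_sum fun j _ => ?_
    rw [← sub_one_mul]
    exact (sub_one_dvd_pow_sub_one _ _).mul_right _

theorem IsSmoothCubic.dvd_eq_zero_of_lt {F : MvPolynomial (Fin 3) k} (hF : IsSmoothCubic F)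
    {G : MvPolynomial (Fin 3) k} {n : ℕ} (hn : n < 3) (hG : G.IsHomogeneous n) (hd : F ∣ G) :
    G = 0 := by
  obtain ⟨c, rfl⟩ := hd
  have := homogeneousComponent_mul_eq_zero_of_lt hF.isHomogeneous hn c
  rwa [homogeneousComponent_of_mem hG, if_pos rfl] at this

theorem IsSmoothCubic.exists_algHom {k : Type u} [Field k] [IsAlgClosed k]
    {F : MvPolynomial (Fin 3) k} (hF : IsSmoothCubic F) :
    ∃ (L : Type u) (_ : Field L) (_ : Algebra k L) (φ : MvPolynomial (Fin 3) k →ₐ[k] L),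
      φ (X 0) = 1 ∧ ∀ {n : ℕ} {G : MvPolynomial (Fin 3) k}, G.IsHomogeneous n →
        (φ G = 0 ↔ F ∣ G) := by
  have : (Ideal.span {F}).IsPrime := (Ideal.span_singleton_prime hF.ne_zero).2 hF.prime
  let L := FractionRing (MvPolynomial (Fin 3) k ⧸ Ideal.span {F})
  let π : MvPolynomial (Fin 3) k →ₐ[k] L := (IsScalarTower.toAlgHom k
    (MvPolynomial (Fin 3) k ⧸ Ideal.span {F}) L).comp (Ideal.Quotient.mkₐ k (Ideal.span {F}))
  have hπ : ∀ G, π G = 0 ↔ F ∣ G := by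
    intro G
    rw [← Ideal.mem_span_singleton, ← Ideal.Quotient.eq_zero_iff_mem]
    exact map_eq_zero_iff _ (IsFractionRing.injective (MvPolynomial (Fin 3) k ⧸ Ideal.span {F}) L)
  have h0 : π (X 0) ≠ 0 := fun h => X_ne_zero (R := k) (0 : Fin 3)
    (hF.dvd_eq_zero_of_lt (by norm_num) (isHomogeneous_X k _) ((hπ _).1 h))
  refine ⟨L, inferInstance, inferInstance, aeval fun i => (π (X 0))⁻¹ * π (X i), ?_, ?_⟩
  · rw [aeval_X, inv_mul_cancel₀ h0]
  · intro n G hG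
    have h2 : aeval (fun i => π (X i)) G = π G := by
      rw [show (aeval (fun i => π (X i))) = π from (aeval_unique π).symm]
    rw [aeval_smul_of_isHomogeneous hG, h2, mul_eq_zero, hπ]
    exact or_iff_right (pow_ne_zero _ (inv_ne_zero h0))

theorem IsSmoothCubic.exists_functionFieldModel {k : Type u} [Field k] [IsAlgClosed k]
    {F : MvPolynomial (Fin 3) k} (hF : IsSmoothCubic F) :
    ∃ (K : Type u) (_ : Field K) (_ : Algebra k K), Nonempty (FunctionFieldModel F K) := by
  obtain ⟨L, _, _, φ, hX0, hφ⟩ := hF.exists_algHom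
  replace hX0 : φ (X 0 - 1) = 0 := by rw [map_sub, map_one, sub_eq_zero, hX0]
  let D₀ : Derivation k (MvPolynomial (Fin 3) k) (MvPolynomial (Fin 3) k) :=
    pderiv 2 F • pderiv 1 - pderiv 1 F • pderiv 2
  have hD₀ : ∀ G, φ G = 0 → φ (D₀ G) = 0 := by
    intro G hG
    obtain ⟨n, G', hG', c, hc⟩ := exists_isHomogeneous_dvd_sub 0 G
    have : F ∣ G' := by
      rw [← hφ hG', ← sub_add_cancel G' G, hc, map_add, map_mul, hX0, hG, zero_mul, zero_add]
    obtain ⟨b, hb⟩ := this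
    have hGe : G = F * b - (X 0 - 1) * c := by rw [← hb, ← hc]; ring
    have hφF : φ F = 0 := (hφ hF.isHomogeneous).2 dvd_rfl
    have e1 : D₀ F = 0 := by simp [D₀]; ring
    have e2 : D₀ (X 0 - 1) = 0 := by simp [D₀, pderiv_X]
    rw [hGe, map_sub, Derivation.leibniz, Derivation.leibniz, e1, e2, smul_zero, smul_zero,
      add_zero, add_zero, smul_eq_mul, smul_eq_mul, map_sub, map_mul, map_mul, hφF, hX0,
      zero_mul, zero_mul, sub_zero]
  obtain ⟨K, _, _, ψ, δ, h1, h2, h3⟩ := exists_field_derivation_of_algHom φ D₀ hD₀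
  have hψ : aeval (fun i => ψ (X i)) = ψ := (aeval_unique ψ).symm
  refine ⟨K, inferInstance, inferInstance, ⟨⟨fun i => ψ (X i), ?_, ?_, ?_, δ, ?_, ?_⟩⟩⟩
  · rw [← sub_eq_zero, ← map_one ψ, ← map_sub, h1, hX0]
  · intro n G hG
    rw [hψ, h1, hφ hG]
  · intro u
    rw [hψ]
    exact h2 u
  · rw [h3, hψ]
    simp [D₀, pderiv_X]
  · rw [h3, hψ]
    simp [D₀, pderiv_X]

end PolynomialRing

section Taylor

variable {k : Type*} [Field k]

/-- The ideal of the point `a`. -/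
noncomputable def pointIdeal (a : Fin 3 → k) : Ideal (MvPolynomial (Fin 3) k) :=
  Ideal.span (Set.range fun i => X i - C (a i))

theorem X_sub_C_mem_pointIdeal (a : Fin 3 → k) (i : Fin 3) : X i - C (a i) ∈ pointIdeal a :=
  Ideal.subset_span ⟨i, rfl⟩

theorem sub_C_eval_mem_pointIdeal (a : Fin 3 → k) (G : MvPolynomial (Fin 3) k) :
    G - C (eval a G) ∈ pointIdeal a := by
  induction G using MvPolynomial.induction_on with
  | C c => simp
  | add p q hp hq =>
    convert add_mem hp hq using 1
    rw [map_add, map_add]; ring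
  | mul_X p i hp =>
    convert add_mem (Ideal.mul_mem_right (X i) _ hp)
      (Ideal.mul_mem_left _ (C (eval a p)) (X_sub_C_mem_pointIdeal a i)) using 1
    rw [map_mul, eval_X, map_mul]; ring

theorem sub_taylor_mem_pointIdeal_sq (a : Fin 3 → k) (G : MvPolynomial (Fin 3) k) :
    G - C (eval a G) - ∑ i, C (eval a (pderiv i G)) * (X i - C (a i)) ∈ pointIdeal a ^ 2 := by
  induction G using MvPolynomial.induction_on with
  | C c => simp
  | add p q hp hq =>
    convert add_mem hp hq using 1
    simp only [map_add, add_mul, Finset.sum_add_distrib]; ring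
  | mul_X p j hp =>
    have h2 : (p - C (eval a p)) * (X j - C (a j)) ∈ pointIdeal a ^ 2 := by
      rw [sq]
      exact Ideal.mul_mem_mul (sub_C_eval_mem_pointIdeal a p) (X_sub_C_mem_pointIdeal a j)
    convert add_mem (Ideal.mul_mem_left _ (C (a j)) hp) h2 using 1
    have h3 : ∀ i, C (eval a (pderiv i (p * X j))) * (X i - C (a i)) =
        C (a j) * (C (eval a (pderiv i p)) * (X i - C (a i))) +
          if j = i then C (eval a p) * (X j - C (a j)) else 0 := by
      intro i
      rw [Derivation.leibniz, pderiv_X, Pi.single_apply]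
      split_ifs with h
      · subst h; simp; ring
      · simp; ring
    rw [Finset.sum_congr rfl fun i _ => h3 i, Finset.sum_add_distrib, ← Finset.mul_sum,
      Finset.sum_ite_eq, if_pos (Finset.mem_univ j), map_mul, eval_X, map_mul]
    ring

end Taylor

namespace FunctionFieldModel

variable {k : Type u} [Field k] {F : MvPolynomial (Fin 3) k} {K : Type u} [Field K] [Algebra k K]
  (M : FunctionFieldModel F K)

theorem x_ne_zero (hF : IsSmoothCubic F) (l : Fin 3) : M.x l ≠ 0 := fun h =>
  X_ne_zero (R := k) l (hF.dvd_eq_zero_of_lt (by norm_num) (isHomogeneous_X k l)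
    ((M.aeval_eq_zero_iff (isHomogeneous_X k l)).1 (by rw [aeval_X, h])))

theorem sum_X_mul_pderiv (hF : IsSmoothCubic F) :
    M.x 0 * aeval M.x (pderiv 0 F) + M.x 1 * aeval M.x (pderiv 1 F) +
      M.x 2 * aeval M.x (pderiv 2 F) = 0 := by
  have h := congrArg (aeval M.x) hF.isHomogeneous.sum_X_mul_pderiv
  rw [map_nsmul, (M.aeval_eq_zero_iff hF.isHomogeneous).2 dvd_rfl, Fin.sum_univ_three] at h
  simpa using h

theorem exists_wronskian_eq (hF : IsSmoothCubic F) (i j : Fin 3) :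
    ∃ H : MvPolynomial (Fin 3) k, H.IsHomogeneous 2 ∧
      M.x i * M.δ (M.x j) - M.x j * M.δ (M.x i) = aeval M.x H := by
  have hsum := M.sum_X_mul_pderiv hF
  have hp : ∀ c, (pderiv c F).IsHomogeneous 2 := fun c => hF.isHomogeneous.pderiv
  rw [M.x_zero] at hsum
  have key : ∀ i j, i ≤ j → ∃ H : MvPolynomial (Fin 3) k, H.IsHomogeneous 2 ∧
      M.x i * M.δ (M.x j) - M.x j * M.δ (M.x i) = aeval M.x H := by
    intro i j hij
    rcases hij.eq_or_lt with rfl | hij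
    · exact ⟨0, isHomogeneous_zero _ _ _, by simp⟩
    · fin_cases i <;> fin_cases j <;> first | exact absurd hij (by decide) | skip
      · exact ⟨pderiv 2 F, hp 2, by simp [M.x_zero, M.δ_one]⟩
      · exact ⟨-pderiv 1 F, (hp 1).neg, by simp [M.x_zero, M.δ_two]⟩
      · refine ⟨pderiv 0 F, hp 0, ?_⟩
        simp only [Fin.mk_one, Fin.reduceFinMk, M.δ_one, M.δ_two]
        linear_combination - hsum
  rcases le_total i j with h | h
  · exact key i j h
  · obtain ⟨H, hH, he⟩ := key j i h
    exact ⟨-H, hH.neg, by rw [map_neg, ← he]; ring⟩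

/-- The affine coordinates on the chart where the `l`-th coordinate does not vanish. -/
noncomputable def t (l i : Fin 3) : K := (M.x l)⁻¹ * M.x i

theorem t_self (hF : IsSmoothCubic F) (l : Fin 3) : M.t l l = 1 :=
  inv_mul_cancel₀ (M.x_ne_zero hF l)

theorem aeval_t {n : ℕ} {G : MvPolynomial (Fin 3) k} (hG : G.IsHomogeneous n) (l : Fin 3) :
    aeval (M.t l) G = (M.x l)⁻¹ ^ n * aeval M.x G :=
  aeval_smul_of_isHomogeneous hG _ _

theorem aeval_t_ne_zero (hF : IsSmoothCubic F) {l : Fin 3} {P : Fin 3 → k} (hl : P l = 1)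
    (hP : eval P F = 0) {H : MvPolynomial (Fin 3) k} (hH : eval P H ≠ 0) :
    aeval (M.t l) H ≠ 0 := by
  intro h0
  obtain ⟨n, H', hH', c, hc⟩ := exists_isHomogeneous_dvd_sub l H
  have h1 : aeval (M.t l) H' = 0 := by
    rw [← sub_add_cancel H' H, hc, map_add, h0, map_mul, map_sub, aeval_X, M.t_self hF]
    simp
  rw [M.aeval_t hH', mul_eq_zero, M.aeval_eq_zero_iff hH'] at h1
  obtain ⟨b, hb⟩ := h1.resolve_left (pow_ne_zero _ (inv_ne_zero (M.x_ne_zero hF l)))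
  apply hH
  have : H = F * b - (X l - 1) * c := by rw [← hb, ← hc]; ring
  rw [this]
  simp [hP, hl]

theorem exists_fraction_t (hF : IsSmoothCubic F) (l : Fin 3) (u : K) :
    ∃ G H : MvPolynomial (Fin 3) k, aeval (M.t l) H ≠ 0 ∧
      u * aeval (M.t l) H = aeval (M.t l) G := by
  have key : ∀ G : MvPolynomial (Fin 3) k, ∃ (n : ℕ) (G' : MvPolynomial (Fin 3) k),
      aeval (M.t l) G' = (M.x l)⁻¹ ^ n * aeval M.x G := by
    intro G
    obtain ⟨n, G', hG', c, hc⟩ := exists_isHomogeneous_dvd_sub 0 G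
    refine ⟨n, G', ?_⟩
    rw [M.aeval_t hG', ← sub_add_cancel G' G, hc, map_add, map_mul, map_sub, aeval_X, M.x_zero]
    simp
  have hX0 : aeval (M.t l) (X 0 : MvPolynomial (Fin 3) k) = (M.x l)⁻¹ := by
    rw [aeval_X, t, M.x_zero, mul_one]
  obtain ⟨G, H, h0, h⟩ := M.exists_fraction u
  obtain ⟨m, G', hG'⟩ := key G
  obtain ⟨n, H', hH'⟩ := key H
  have hl := M.x_ne_zero hF l
  refine ⟨X 0 ^ n * G', X 0 ^ m * H', ?_, ?_⟩
  · rw [map_mul, map_pow, hX0, hH']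
    positivity
  · rw [map_mul, map_mul, map_pow, map_pow, hX0, hG', hH', ← h]
    ring

/-- The local ring of the curve at the point `P` of the `l`-th chart. -/
noncomputable def localRing (l : Fin 3) (P : Fin 3 → k) : Subalgebra k K where
  carrier := {u | ∃ G H : MvPolynomial (Fin 3) k, eval P H ≠ 0 ∧
    u * aeval (M.t l) H = aeval (M.t l) G}
  mul_mem' := by
    rintro u v ⟨G, H, h, e⟩ ⟨G', H', h', e'⟩
    refine ⟨G * G', H * H', by simp [h, h'], ?_⟩
    rw [map_mul, map_mul, ← e, ← e']; ring
  add_mem' := by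
    rintro u v ⟨G, H, h, e⟩ ⟨G', H', h', e'⟩
    refine ⟨G * H' + G' * H, H * H', by simp [h, h'], ?_⟩
    rw [map_add, map_mul, map_mul, map_mul, ← e, ← e']; ring
  algebraMap_mem' c := ⟨C c, 1, by simp, by simp⟩

theorem aeval_t_mem_localRing (l : Fin 3) (P : Fin 3 → k) (G : MvPolynomial (Fin 3) k) :
    aeval (M.t l) G ∈ M.localRing l P :=
  ⟨G, 1, by simp, by simp⟩

theorem t_mem_localRing (l : Fin 3) (P : Fin 3 → k) (i : Fin 3) :
    M.t l i ∈ M.localRing l P := by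
  simpa using M.aeval_t_mem_localRing l P (X i)

theorem inv_aeval_t_mem_localRing (hF : IsSmoothCubic F) {l : Fin 3} {P : Fin 3 → k}
    (hl : P l = 1) (hP : eval P F = 0) {H : MvPolynomial (Fin 3) k} (hH : eval P H ≠ 0) :
    (aeval (M.t l) H)⁻¹ ∈ M.localRing l P :=
  ⟨1, H, hH, by rw [inv_mul_cancel₀ (M.aeval_t_ne_zero hF hl hP hH), map_one]⟩

theorem δ_mem_localRing (hF : IsSmoothCubic F) {l : Fin 3} {P : Fin 3 → k} (hl : P l = 1)
    (hP : eval P F = 0) {u : K} (hu : u ∈ M.localRing l P) : M.δ u ∈ M.localRing l P := by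
  have hxl := M.x_ne_zero hF l
  have ht : ∀ i, M.δ (M.t l i) ∈ M.localRing l P := by
    intro i
    obtain ⟨H, hH, h⟩ := M.exists_wronskian_eq hF l i
    have : M.δ (M.t l i) = aeval (M.t l) H := by
      rw [M.aeval_t hH, ← h, t, Derivation.leibniz, Derivation.leibniz_inv]
      simp only [smul_eq_mul]
      field_simp
      ring
    rw [this]
    exact M.aeval_t_mem_localRing l P H
  have hG : ∀ G : MvPolynomial (Fin 3) k, M.δ (aeval (M.t l) G) ∈ M.localRing l P := by
    intro G
    induction G using MvPolynomial.induction_on with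
    | C c => simp
    | add p q hp hq =>
      rw [map_add, map_add]
      exact add_mem hp hq
    | mul_X p i hp =>
      rw [map_mul, aeval_X, Derivation.leibniz]
      exact add_mem (mul_mem (M.aeval_t_mem_localRing l P p) (ht i))
        (mul_mem (M.t_mem_localRing l P i) hp)
  have hu' := hu
  obtain ⟨G, H, hH, h⟩ := hu
  have h0 := M.aeval_t_ne_zero hF hl hP hH
  have h2 := congrArg M.δ h
  rw [Derivation.leibniz] at h2
  have : M.δ u = (M.δ (aeval (M.t l) G) - u * M.δ (aeval (M.t l) H)) * (aeval (M.t l) H)⁻¹ := by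
    rw [← h2]
    simp only [smul_eq_mul]
    field_simp
    ring
  rw [this]
  exact mul_mem (sub_mem (hG G) (mul_mem hu' (hG H))) (M.inv_aeval_t_mem_localRing hF hl hP hH)

/-- Evaluation of polynomials in the affine coordinates, as a map to the local ring. -/
noncomputable def toLocalRing (l : Fin 3) (P : Fin 3 → k) :
    MvPolynomial (Fin 3) k →ₐ[k] M.localRing l P :=
  (aeval (M.t l)).codRestrict (M.localRing l P) (M.aeval_t_mem_localRing l P)

theorem isUnit_toLocalRing (hF : IsSmoothCubic F) {l : Fin 3} {P : Fin 3 → k}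
    (hl : P l = 1) (hP : eval P F = 0) {H : MvPolynomial (Fin 3) k} (hH : eval P H ≠ 0) :
    IsUnit (M.toLocalRing l P H) :=
  IsUnit.of_mul_eq_one ⟨_, M.inv_aeval_t_mem_localRing hF hl hP hH⟩
    (Subtype.ext (mul_inv_cancel₀ (M.aeval_t_ne_zero hF hl hP hH)))

theorem exists_surjective_atPrime (hF : IsSmoothCubic F) {l : Fin 3} {P : Fin 3 → k}
    (hl : P l = 1) (hP : eval P F = 0) [(RingHom.ker (eval P)).IsPrime] :
    ∃ f : Localization.AtPrime (RingHom.ker (eval P)) →+* M.localRing l P,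
      Function.Surjective f := by
  have hu : ∀ y : (RingHom.ker (eval P)).primeCompl, IsUnit ((M.toLocalRing l P).toRingHom y) :=
    fun y => M.isUnit_toLocalRing hF hl hP fun h => y.2 ((RingHom.mem_ker).2 h)
  refine ⟨IsLocalization.lift hu, fun u => ?_⟩
  obtain ⟨G, H, hH, h⟩ := u.2
  refine ⟨IsLocalization.mk' _ G (⟨H, fun h => hH ((RingHom.mem_ker).1 h)⟩ :
    (RingHom.ker (eval P)).primeCompl), ?_⟩
  rw [IsLocalization.lift_mk'_spec]
  refine Subtype.ext ?_
  change aeval (M.t l) G = aeval (M.t l) H * u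
  rw [← h, mul_comm]

theorem exists_pderiv_ne_zero (hF : IsSmoothCubic F) {l : Fin 3} {P : Fin 3 → k}
    (hl : P l = 1) (hP : eval P F = 0) : ∃ a, a ≠ l ∧ eval P (pderiv a F) ≠ 0 := by
  by_contra! h
  have hsum := congrArg (eval P) hF.isHomogeneous.sum_X_mul_pderiv
  rw [map_sum, Finset.sum_eq_single l, map_mul, eval_X, hl, one_mul, map_nsmul, hP, smul_zero]
    at hsum
  · have := hF.eq_zero_of_singular P hP fun i => by
      by_cases hi : i = l
      · rw [hi, hsum]
      · exact h i hi
    rw [this] at hl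
    exact zero_ne_one hl
  · intro b _ hb
    rw [map_mul, h b hb, mul_zero]
  · simp

theorem valuationRing_localRing (hF : IsSmoothCubic F) {l : Fin 3} {P : Fin 3 → k}
    (hl : P l = 1) (hP : eval P F = 0) : ValuationRing (M.localRing l P) := by
  have : (RingHom.ker (eval P)).IsPrime := RingHom.ker_isPrime _
  obtain ⟨f, hf⟩ := M.exists_surjective_atPrime hF hl hP
  have : IsNoetherianRing (Localization.AtPrime (RingHom.ker (eval P))) :=
    IsLocalization.isNoetherianRing (RingHom.ker (eval P)).primeCompl _ inferInstance
  have : IsNoetherianRing (M.localRing l P) := isNoetherianRing_of_surjective _ _ f hf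
  have : IsLocalRing (M.localRing l P) := IsLocalRing.of_surjective' f hf
  refine ((tfae_of_isNoetherianRing_of_isLocalRing_of_isDomain (M.localRing l P)).out 1 4 :
    ValuationRing (M.localRing l P) ↔
      (IsLocalRing.maximalIdeal (M.localRing l P)).IsPrincipal).2 ?_
  set 𝔪 := IsLocalRing.maximalIdeal (M.localRing l P)
  let τ := M.toLocalRing l P
  let y : Fin 3 → M.localRing l P := fun i => τ (X i - C (P i))
  have hmap : (pointIdeal P).map τ = Ideal.span (Set.range y) := by
    rw [pointIdeal, Ideal.map_span, ← Set.range_comp]; rfl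
  have hle : 𝔪 ≤ Ideal.span (Set.range y) := by
    intro u hu
    obtain ⟨G, H, hH, h⟩ := u.2
    have hu1 : u * τ H = τ G := Subtype.ext h
    have hHu := M.isUnit_toLocalRing hF hl hP hH
    have hG : eval P G = 0 := by
      by_contra hG
      have := M.isUnit_toLocalRing hF hl hP hG
      rw [show M.toLocalRing l P G = u * τ H from hu1.symm] at this
      exact (IsLocalRing.mem_maximalIdeal _).1 hu (isUnit_of_mul_isUnit_left this)
    have h1 := sub_C_eval_mem_pointIdeal P G
    rw [hG, C_0, sub_zero] at h1
    have h2 := Ideal.mem_map_of_mem τ h1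
    rw [hmap, ← hu1] at h2
    exact (Ideal.mul_unit_mem_iff_mem _ hHu).1 h2
  have hy : ∀ i, y i ∈ 𝔪 := by
    intro i
    rw [IsLocalRing.mem_maximalIdeal]
    intro hu
    obtain ⟨v, hv⟩ := hu.exists_right_inv
    obtain ⟨G, H, hH, h⟩ := v.2
    have h3 : aeval (M.t l) ((X i - C (P i)) * G - H) = 0 := by
      rw [map_sub, map_mul, ← h]
      have := congrArg Subtype.val hv
      change aeval (M.t l) (X i - C (P i)) * (v : K) = 1 at this
      linear_combination aeval (M.t l) H * this
    refine M.aeval_t_ne_zero hF hl hP (H := (X i - C (P i)) * G - H) ?_ h3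
    simpa using hH
  have hyl : y l = 0 := by
    refine Subtype.ext ?_
    change aeval (M.t l) (X l - C (P l)) = 0
    rw [map_sub, aeval_X, M.t_self hF, hl]; simp
  obtain ⟨a, hal, ha⟩ := exists_pderiv_ne_zero hF hl hP
  obtain ⟨b, hb⟩ : ∃ b : Fin 3, ∀ i, i = a ∨ i = l ∨ i = b := by
    have h : ∀ a l : Fin 3, a ≠ l → ∃ b : Fin 3, ∀ i, i = a ∨ i = l ∨ i = b := by decide
    exact h a l hal
  have htaylor : ∑ i, algebraMap k _ (eval P (pderiv i F)) * y i ∈ 𝔪 ^ 2 := by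
    have h1 := Ideal.mem_map_of_mem τ (sub_taylor_mem_pointIdeal_sq P F)
    have hτF : τ F = 0 := Subtype.ext (by
      change aeval (M.t l) F = 0
      rw [M.aeval_t hF.isHomogeneous, (M.aeval_eq_zero_iff hF.isHomogeneous).2 dvd_rfl, mul_zero])
    rw [Ideal.map_pow, hmap, hP, C_0, sub_zero, map_sub, hτF, zero_sub, neg_mem_iff, map_sum] at h1
    have h2 : Ideal.span (Set.range y) ≤ 𝔪 := Ideal.span_le.2 (by rintro _ ⟨i, rfl⟩; exact hy i)
    convert Ideal.pow_right_mono h2 2 h1 using 2 with i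
    rw [map_mul, ← algebraMap_eq, AlgHom.commutes]
    rfl
  have hya : y a ∈ Ideal.span {y b} ⊔ 𝔪 • 𝔪 := by
    by_cases hab : b = a
    · exact Ideal.mem_sup_left (hab ▸ Ideal.mem_span_singleton_self _)
    have h1 : algebraMap k (M.localRing l P) (eval P (pderiv a F)) * y a =
        (∑ i, algebraMap k _ (eval P (pderiv i F)) * y i) -
          ∑ i ∈ Finset.univ.erase a, algebraMap k _ (eval P (pderiv i F)) * y i := by
      rw [← Finset.add_sum_erase _ _ (Finset.mem_univ a)]; ring
    have h2 : algebraMap k (M.localRing l P) (eval P (pderiv a F)) * y a ∈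
        Ideal.span {y b} ⊔ 𝔪 • 𝔪 := by
      rw [h1]
      refine sub_mem (Ideal.mem_sup_right ?_) (sum_mem fun i hi => Ideal.mem_sup_left ?_)
      · rw [smul_eq_mul, ← sq]; exact htaylor
      · rcases hb i with h | h | h
        · exact absurd h (Finset.ne_of_mem_erase hi)
        · rw [h, hyl, mul_zero]; exact zero_mem _
        · rw [h]; exact Ideal.mul_mem_left _ _ (Ideal.mem_span_singleton_self _)
    exact (Ideal.unit_mul_mem_iff_mem _ ((IsUnit.mk0 _ ha).map (algebraMap k _))).1 h2
  have hle2 : 𝔪 ≤ Ideal.span {y b} := by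
    refine Submodule.le_of_le_smul_of_le_jacobson_bot (I := 𝔪) (IsNoetherian.noetherian _)
      (IsLocalRing.maximalIdeal_le_jacobson _) (hle.trans (Ideal.span_le.2 ?_))
    rintro _ ⟨i, rfl⟩
    rcases hb i with h | h | h
    · rw [h]; exact hya
    · rw [h, hyl]; exact zero_mem _
    · rw [h]; exact Ideal.mem_sup_left (Ideal.mem_span_singleton_self _)
  exact ⟨y b, le_antisymm hle2 (Ideal.span_le.2 (by simpa using hy b))⟩

theorem mem_localRing_or_inv_mem (hF : IsSmoothCubic F) {l : Fin 3} {P : Fin 3 → k}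
    (hl : P l = 1) (hP : eval P F = 0) (u : K) :
    u ∈ M.localRing l P ∨ u⁻¹ ∈ M.localRing l P := by
  have := M.valuationRing_localRing hF hl hP
  obtain ⟨G, H, h0, h⟩ := M.exists_fraction_t hF l u
  obtain ⟨c, hc⟩ := ValuationRing.cond (M.toLocalRing l P G) (M.toLocalRing l P H)
  rcases hc with hc | hc
  · right
    have hc' : aeval (M.t l) G * (c : K) = aeval (M.t l) H := congrArg Subtype.val hc
    have : u⁻¹ = c := by
      rw [← h, mul_right_comm] at hc'
      exact inv_eq_of_mul_eq_one_right (mul_right_cancel₀ h0 (by rw [hc', one_mul]))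
    rw [this]
    exact c.2
  · left
    have hc' : aeval (M.t l) H * (c : K) = aeval (M.t l) G := congrArg Subtype.val hc
    have : u = c := by
      rw [← h, mul_comm u] at hc'
      exact (mul_left_cancel₀ h0 hc').symm
    rw [this]
    exact c.2

/-- The sections of `𝒪(n)`, identified with functions through the trivialization `x 0 = 1`. -/
noncomputable def sections : ℤ → Submodule k K
  | Int.ofNat n => (homogeneousSubmodule (Fin 3) k n).map (aeval M.x).toLinearMap
  | Int.negSucc _ => ⊥

theorem mem_sections_natCast {n : ℕ} {u : K} :
    u ∈ M.sections n ↔ ∃ G : MvPolynomial (Fin 3) k, G.IsHomogeneous n ∧ aeval M.x G = u :=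
  Iff.rfl

theorem eq_zero_of_mem_sections_of_neg {n : ℤ} (hn : n < 0) {u : K} (hu : u ∈ M.sections n) :
    u = 0 := by
  obtain ⟨m, rfl⟩ := Int.exists_eq_neg_ofNat hn.le
  match m, hn, hu with
  | m + 1, _, hu => exact hu

theorem aeval_mem_sections {n : ℕ} {G : MvPolynomial (Fin 3) k} (hG : G.IsHomogeneous n) :
    aeval M.x G ∈ M.sections n :=
  M.mem_sections_natCast.2 ⟨G, hG, rfl⟩

theorem mul_aeval_mem_sections {m : ℕ} {n : ℤ} {G : MvPolynomial (Fin 3) k}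
    (hG : G.IsHomogeneous m) {u : K} (hu : u ∈ M.sections n) :
    u * aeval M.x G ∈ M.sections (n + m) := by
  rcases lt_or_ge n 0 with hn | hn
  · rw [M.eq_zero_of_mem_sections_of_neg hn hu, zero_mul]
    exact zero_mem _
  · lift n to ℕ using hn
    obtain ⟨G', hG', rfl⟩ := M.mem_sections_natCast.1 hu
    rw [← map_mul, ← Nat.cast_add]
    exact M.aeval_mem_sections (hG'.mul hG)

theorem mem_sections_of_mul_x_mem (hF : IsSmoothCubic F) {d : ℤ} {v : K}
    (h : ∀ i, v * M.x i ∈ M.sections (d + 1)) : v ∈ M.sections d := by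
  have hdvd : ∀ {n : ℕ} {G : Fin 3 → MvPolynomial (Fin 3) k}, (∀ i, (G i).IsHomogeneous n) →
      (∀ i, aeval M.x (G i) = v * M.x i) → ∀ i j, F ∣ X i * G j - X j * G i := by
    intro n G hG hGv i j
    rw [← M.aeval_eq_zero_iff (n := 1 + n)
      (((isHomogeneous_X k i).mul (hG j)).sub ((isHomogeneous_X k j).mul (hG i))), map_sub,
      map_mul, map_mul, aeval_X, aeval_X, hGv, hGv]
    ring
  rcases lt_trichotomy d (-1) with hd | rfl | hd
  · have := M.eq_zero_of_mem_sections_of_neg (by omega) (h 0)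
    rw [M.x_zero, mul_one] at this
    rw [this]; exact zero_mem _
  · choose G hG hGv using fun i => (M.mem_sections_natCast (n := 0)).1 (h i)
    have hcross : ∀ i j, X i * G j = X j * G i := fun i j => by
      rw [← sub_eq_zero]
      exact hF.dvd_eq_zero_of_lt (n := 1 + 0) (by norm_num)
        (((isHomogeneous_X k i).mul (hG j)).sub ((isHomogeneous_X k j).mul (hG i)))
        (hdvd hG hGv i j)
    obtain ⟨w, hw⟩ := exists_eq_X_mul_of_cross_eq_zero hcross
    have h0 : G 0 = 0 := by
      rw [← homogeneousComponent_mul_eq_zero_of_lt (isHomogeneous_X k (0 : Fin 3)) zero_lt_one w,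
        ← hw, homogeneousComponent_of_mem (hG 0), if_pos rfl]
    have := hGv 0
    rw [h0, map_zero, M.x_zero, mul_one] at this
    rw [← this]; exact zero_mem _
  · lift d to ℕ using (by omega)
    choose G hG hGv using fun i => (M.mem_sections_natCast (n := d + 1)).1 (by exact_mod_cast h i)
    obtain ⟨w, hw, hwG⟩ := exists_isHomogeneous_dvd_sub_X_mul hF.ne_zero hF.isHomogeneous hG
      (hdvd hG hGv)
    refine M.mem_sections_natCast.2 ⟨w, hw, ?_⟩
    have h1 := (M.aeval_eq_zero_iff ((hG 0).sub (by
      have := (isHomogeneous_X k (0 : Fin 3)).mul hw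
      rwa [add_comm] at this))).2 (hwG 0)
    rw [map_sub, map_mul, aeval_X, hGv, M.x_zero, mul_one, one_mul, sub_eq_zero] at h1
    exact h1.symm

/-- The polynomials all of whose homogeneous components clear the denominators of `u`, regarded as
a rational section of `𝒪(n)`. -/
noncomputable def denominators (n : ℤ) (u : K) : Ideal (MvPolynomial (Fin 3) k) where
  carrier := {H | ∀ d : ℕ, u * aeval M.x (homogeneousComponent d H) ∈ M.sections (n + d)}
  zero_mem' d := by simp
  add_mem' {G H} hG hH d := by
    rw [map_add, map_add, mul_add]
    exact add_mem (hG d) (hH d)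
  smul_mem' G H hH := by
    change ∀ d : ℕ, u * aeval M.x (homogeneousComponent d (G * H)) ∈ M.sections (n + d)
    induction G using MvPolynomial.induction_on with
    | C c =>
      intro d
      rw [homogeneousComponent_C_mul, map_mul, aeval_C, mul_left_comm, ← Algebra.smul_def]
      exact Submodule.smul_mem _ _ (hH d)
    | add p q hp hq =>
      intro d
      rw [add_mul, map_add, map_add, mul_add]
      exact add_mem (hp d) (hq d)
    | mul_X p i hp =>
      intro d
      rw [mul_comm p, mul_assoc]
      rcases d with _ | d
      · rw [homogeneousComponent_mul_eq_zero_of_lt (isHomogeneous_X k i) zero_lt_one]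
        simp
      · rw [add_comm d 1, homogeneousComponent_mul_of_isHomogeneous (isHomogeneous_X k i),
          map_mul, mul_left_comm, mul_comm, add_comm 1 d, Nat.cast_add, ← add_assoc]
        exact M.mul_aeval_mem_sections (isHomogeneous_X k i) (hp d)

theorem mem_denominators_of_isHomogeneous {n : ℤ} {u : K} {d : ℕ} {H : MvPolynomial (Fin 3) k}
    (hH : H.IsHomogeneous d) (h : u * aeval M.x H ∈ M.sections (n + d)) :
    H ∈ M.denominators n u := by
  intro e
  rw [homogeneousComponent_of_mem hH]
  split_ifs with he
  · rw [he]; exact h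
  · simp

theorem exists_mem_denominators (hF : IsSmoothCubic F) {n : ℤ} {u : K} {l : Fin 3}
    {P : Fin 3 → k} (hl : P l = 1) (h : u * (M.x l) ^ (-n) ∈ M.localRing l P) :
    ∃ (d : ℕ) (H : MvPolynomial (Fin 3) k), H.IsHomogeneous d ∧ eval P H ≠ 0 ∧
      H ∈ M.denominators n u := by
  have hxl := M.x_ne_zero hF l
  obtain ⟨G, H, hH, e⟩ := h
  obtain ⟨a, H', hH', c, hc⟩ := exists_isHomogeneous_dvd_sub l H
  obtain ⟨b, G', hG', c', hc'⟩ := exists_isHomogeneous_dvd_sub l G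
  have h1 : aeval (M.t l) H = aeval (M.t l) H' := by
    rw [← sub_add_cancel H' H, hc, map_add, map_mul, map_sub, aeval_X, M.t_self hF]; simp
  have h2 : aeval (M.t l) G = aeval (M.t l) G' := by
    rw [← sub_add_cancel G' G, hc', map_add, map_mul, map_sub, aeval_X, M.t_self hF]; simp
  have h3 : eval P H' = eval P H := by
    rw [← sub_add_cancel H' H, hc, map_add, map_mul, map_sub, eval_X, hl]; simp
  rw [h1, h2, M.aeval_t hH', M.aeval_t hG'] at e
  obtain ⟨s, hs⟩ : ∃ s : ℕ, (s : ℤ) = n + n.natAbs := ⟨(n + n.natAbs).toNat, by omega⟩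
  have hhom := hH'.mul ((isHomogeneous_X k l).pow (b + n.natAbs))
  refine ⟨_, H' * X l ^ (b + n.natAbs), hhom, by simp [h3, hH, hl], ?_⟩
  apply M.mem_denominators_of_isHomogeneous hhom
  have hGhom := hG'.mul ((isHomogeneous_X k l).pow (a + s))
  have hdeg : n + ((a + 1 * (b + n.natAbs) : ℕ) : ℤ) = ((b + 1 * (a + s) : ℕ) : ℤ) := by
    push_cast; rw [hs]; push_cast; ring
  rw [hdeg]
  convert M.aeval_mem_sections hGhom using 1
  rw [map_mul, map_mul, map_pow, map_pow, aeval_X]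
  have e1 : aeval M.x G' = M.x l ^ b * (u * M.x l ^ (-n) * ((M.x l)⁻¹ ^ a * aeval M.x H')) := by
    rw [e, inv_pow, mul_inv_cancel_left₀ (pow_ne_zero _ hxl)]
  have e2 : M.x l ^ s = M.x l ^ n * M.x l ^ n.natAbs := by
    rw [← zpow_natCast, hs, zpow_add₀ hxl, zpow_natCast]
  rw [e1, pow_add, pow_add, e2, zpow_neg, inv_pow]
  field_simp

theorem mem_sections_of_forall_localRing [IsAlgClosed k] (hF : IsSmoothCubic F) {n : ℤ} {u : K}
    (h : ∀ (l : Fin 3) (P : Fin 3 → k), P l = 1 → eval P F = 0 →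
      u * (M.x l) ^ (-n) ∈ M.localRing l P) : u ∈ M.sections n := by
  have hzero : ∀ P : Fin 3 → k, (∀ H ∈ M.denominators n u, eval P H = 0) → P = 0 := by
    intro P hP
    by_contra hP0
    obtain ⟨l, hl⟩ := Function.ne_iff.1 hP0
    have hF0 : eval P F = 0 := hP F (M.mem_denominators_of_isHomogeneous hF.isHomogeneous (by
      rw [(M.aeval_eq_zero_iff hF.isHomogeneous).2 dvd_rfl, mul_zero]; exact zero_mem _))
    have hscale : ∀ {d : ℕ} {H : MvPolynomial (Fin 3) k}, H.IsHomogeneous d →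
        eval (fun i => (P l)⁻¹ * P i) H = (P l)⁻¹ ^ d * eval P H := fun hH =>
      aeval_smul_of_isHomogeneous hH _ _
    have hl1 : (fun i => (P l)⁻¹ * P i) l = 1 := inv_mul_cancel₀ hl
    obtain ⟨d, H, hH, hHP, hmem⟩ := M.exists_mem_denominators hF hl1
      (h l _ hl1 (by rw [hscale hF.isHomogeneous, hF0, mul_zero]))
    rw [hscale hH, hP H hmem, mul_zero] at hHP
    exact hHP rfl
  have hrad : idealOfVars (Fin 3) k ≤ (M.denominators n u).radical := by
    rw [← vanishingIdeal_zeroLocus_eq_radical (K := k), idealOfVars, Ideal.span_le]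
    rintro _ ⟨i, rfl⟩
    intro P hP
    rw [hzero P hP]
    simp
  obtain ⟨N, hN⟩ := Ideal.exists_pow_le_of_le_radical_of_fg hrad (idealOfVars_fg _ _)
  have hdesc : ∀ j ≤ N, ∀ H : MvPolynomial (Fin 3) k, H.IsHomogeneous j →
      u * aeval M.x H ∈ M.sections (n + j) := by
    intro j hj
    induction hj using Nat.decreasingInduction with
    | self =>
      intro H hH
      have hmem : H ∈ idealOfVars (Fin 3) k ^ N := by
        rw [mem_pow_idealOfVars_iff']
        intro m hm
        by_contra hc
        have : m.degree = N := by
          rw [Finsupp.degree_eq_weight_one]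
          exact hH hc
        omega
      have := hN hmem N
      rwa [homogeneousComponent_of_mem hH, if_pos rfl] at this
    | of_succ j hj ih =>
      intro H hH
      refine M.mem_sections_of_mul_x_mem hF fun i => ?_
      have := ih (H * X i) (hH.mul (isHomogeneous_X k i))
      rw [map_mul, aeval_X] at this
      rw [mul_assoc, add_assoc]
      exact_mod_cast this
  simpa using hdesc 0 (Nat.zero_le _) 1 (isHomogeneous_one _ _)

end FunctionFieldModel

theorem derivation_aeval_eq_sum {k A : Type*} [CommRing k] [CommRing A] [Algebra k A]
    (D : Derivation k A A) (y : Fin 3 → A) (G : MvPolynomial (Fin 3) k) :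
    D (aeval y G) = ∑ i, aeval y (pderiv i G) * D (y i) := by
  induction G using MvPolynomial.induction_on with
  | C c => simp
  | add p q hp hq => simp only [map_add, hp, hq, add_mul, Finset.sum_add_distrib]
  | mul_X p i hp =>
    simp only [map_mul, aeval_X, Derivation.leibniz, hp, smul_eq_mul, map_add, pderiv_X,
      add_mul, Finset.sum_add_distrib, Finset.mul_sum]
    congr 1
    · rw [Finset.sum_eq_single i]
      · simp
      · intro j _ hj; simp [hj.symm]
      · simp
    · exact Finset.sum_congr rfl fun j _ => by ring

/-- The subfield of `p`-th powers, as an extension of a perfect base field. -/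
def powIntermediateField (k K : Type*) (p : ℕ) [Field k] [IsAlgClosed k] [Field K] [Algebra k K]
    [Fact p.Prime] [CharP K p] : IntermediateField k K :=
  (frobenius K p).fieldRange.toIntermediateField fun c => by
    obtain ⟨z, rfl⟩ := IsAlgClosed.exists_pow_nat_eq c (Fact.out : p.Prime).pos
    exact ⟨algebraMap k K z, by simp [frobenius_def]⟩

theorem mem_powIntermediateField {k K : Type*} {p : ℕ} [Field k] [IsAlgClosed k] [Field K]
    [Algebra k K] [Fact p.Prime] [CharP K p] {u : K} :
    u ∈ powIntermediateField k K p ↔ ∃ r, r ^ p = u :=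
  Iff.rfl

open IntermediateField in
theorem exists_pow_eq_of_derivation_eq_zero {k K : Type*} {p : ℕ} [Field k] [IsAlgClosed k]
    [Field K] [Algebra k K] [Fact p.Prime] [CharP K p] (δ : Derivation k K K) {y : K}
    (hy : (powIntermediateField k K p)⟮y⟯ = ⊤) (hδ : δ y ≠ 0) {f : K} (hf : δ f = 0) :
    ∃ r, r ^ p = f := by
  set L := powIntermediateField k K p with hL
  have hp := (Fact.out : p.Prime)
  rw [← mem_powIntermediateField (k := k), ← hL]
  by_contra hfL
  have hpow : ∀ z : K, z ^ p ∈ L := fun z => ⟨z, rfl⟩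
  have hroot : ∀ z : K,
      Polynomial.aeval z (Polynomial.X ^ p - Polynomial.C (⟨_, hpow z⟩ : L)) = 0 :=
    fun z => by
      rw [map_sub, map_pow, Polynomial.aeval_X, Polynomial.aeval_C]
      exact sub_self _
  have hmonic : ∀ z : K, (Polynomial.X ^ p - Polynomial.C (⟨_, hpow z⟩ : L)).Monic := fun z =>
    Polynomial.monic_X_pow_sub_C _ hp.ne_zero
  have hint : ∀ z : K, IsIntegral L z := fun z => ⟨_, hmonic z, hroot z⟩
  have hirr : Irreducible (Polynomial.X ^ p - Polynomial.C (⟨_, hpow f⟩ : L)) := by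
    refine X_pow_sub_C_irreducible_of_prime hp fun b hb => hfL ?_
    have : (b : K) ^ p = f ^ p := congrArg Subtype.val hb
    have := frobenius_inj K p this
    rw [← this]; exact b.2
  have hdegf : Module.finrank L L⟮f⟯ = p := by
    rw [adjoin.finrank (hint f), ← minpoly.eq_of_irreducible_of_monic hirr (hroot f) (hmonic f),
      Polynomial.natDegree_X_pow_sub_C]
  have hdegy : Module.finrank L L⟮y⟯ ≤ p := by
    rw [adjoin.finrank (hint y)]
    exact (Polynomial.natDegree_le_of_dvd (minpoly.dvd _ _ (hroot y)) (hmonic y).ne_zero).trans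
      (Polynomial.natDegree_X_pow_sub_C).le
  have : FiniteDimensional L L⟮y⟯ := adjoin.finiteDimensional (hint y)
  have htop : L⟮f⟯ = L⟮y⟯ := eq_of_le_of_finrank_le (by rw [hy]; exact le_top)
    (by rw [hdegf]; exact hdegy)
  have hvan : ∀ z ∈ L⟮f⟯, δ z = 0 := by
    intro z hz
    induction hz using adjoin_induction with
    | mem x hx => rw [Set.mem_singleton_iff.1 hx, hf]
    | algebraMap z =>
      obtain ⟨_, r, rfl⟩ := z
      change δ (r ^ p) = 0
      rw [Derivation.leibniz_pow, ← Nat.cast_smul_eq_nsmul K, CharP.cast_eq_zero, zero_smul]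
    | add a b _ _ ha hb => rw [map_add, ha, hb, add_zero]
    | inv a _ ha => rw [Derivation.leibniz_inv, ha, smul_zero]
    | mul a b _ _ ha hb => rw [Derivation.leibniz, ha, hb]; simp
  exact hδ (hvan y (by rw [htop, hy]; trivial))

theorem IsSmoothCubic.exists_eval_eq_zero {k : Type*} [Field k] [IsAlgClosed k]
    {F : MvPolynomial (Fin 3) k} (hF : IsSmoothCubic F) :
    ∃ a : Fin 3 → k, a ≠ 0 ∧ eval a F = 0 := by
  by_contra! h
  have hmem : (X 0 : MvPolynomial (Fin 3) k) ∈ (Ideal.span {F}).radical := by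
    rw [← vanishingIdeal_zeroLocus_eq_radical (K := k)]
    intro a ha
    have ha0 : a = 0 := by
      by_contra h0
      exact h a h0 (ha F (Ideal.mem_span_singleton_self F))
    simp [ha0]
  obtain ⟨N, hN⟩ := hmem
  exact X_ne_zero (R := k) (0 : Fin 3) (hF.dvd_eq_zero_of_lt (by norm_num) (isHomogeneous_X k 0)
    (hF.prime.dvd_of_dvd_pow (Ideal.mem_span_singleton.1 hN)))

namespace FunctionFieldModel

variable {k : Type u} [Field k] {F : MvPolynomial (Fin 3) k} {K : Type u} [Field K] [Algebra k K]
  (M : FunctionFieldModel F K)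

open IntermediateField in
theorem adjoin_x_eq_top [IsAlgClosed k] {p : ℕ} [Fact p.Prime] [CharP K p]
    (hF : IsSmoothCubic F) {i j : Fin 3} (hij : i ≠ j) (hi : i ≠ 0) (hj : j ≠ 0)
    (h : aeval M.x (pderiv j F) ≠ 0) : (powIntermediateField k K p)⟮M.x i⟯ = ⊤ := by
  set L := powIntermediateField k K p with hL
  let E := L⟮M.x i⟯
  have : IsScalarTower k E K := IsScalarTower.of_algebraMap_eq fun _ => rfl
  have hall : ∀ l, l = 0 ∨ l = i ∨ l = j := by
    clear * - hij hi hj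
    omega
  have hx0 : M.x 0 ∈ E := by rw [M.x_zero]; exact one_mem _
  have hxi : M.x i ∈ E := mem_adjoin_simple_self _ _
  have hmem : ∀ l, l ≠ j → M.x l ∈ E := fun l hl => by
    rcases hall l with rfl | rfl | rfl
    · exact hx0
    · exact hxi
    · exact absurd rfl hl
  let y : Fin 3 → Polynomial E := fun l =>
    if hl : l = j then Polynomial.X else Polynomial.C ⟨M.x l, hmem l hl⟩
  have hy : ∀ l, Polynomial.aeval (M.x j) (y l) = M.x l := fun l => by
    by_cases hl : l = j
    · simp [y, hl]
    · simp only [y, hl, dite_false, Polynomial.aeval_C]; rfl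
  have hcomp : ∀ G : MvPolynomial (Fin 3) k,
      Polynomial.aeval (M.x j) (aeval y G) = aeval M.x G := fun G => by
    have := comp_aeval_apply y ((Polynomial.aeval (R := E) (M.x j)).restrictScalars k) G
    simp only [AlgHom.restrictScalars_apply, hy] at this
    exact this
  have hder : Polynomial.aeval (M.x j) (Polynomial.derivative (aeval y F)) =
      aeval M.x (pderiv j F) := by
    have := derivation_aeval_eq_sum
      ((Polynomial.derivative' (R := E)).restrictScalars k) y F
    have h2 : Polynomial.derivative (aeval y F) = ∑ l, aeval y (pderiv l F) *
      Polynomial.derivative (y l) := this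
    rw [h2, Finset.sum_eq_single j]
    · simp [y, hcomp]
    · intro l _ hl
      simp [y, hl]
    · simp
  have hpE : CharP E p := (algebraMap E K).charP (algebraMap E K).injective p
  have hpow : M.x j ^ p ∈ E := by
    have : M.x j ^ p ∈ L := ⟨M.x j, rfl⟩
    exact E.algebraMap_mem ⟨_, this⟩
  have hF0 : Polynomial.aeval (M.x j) (aeval y F) = 0 := by
    rw [hcomp, (M.aeval_eq_zero_iff hF.isHomogeneous).2 dvd_rfl]
  have hint : IsIntegral E (M.x j) := by
    refine ⟨Polynomial.X ^ p - Polynomial.C ⟨_, hpow⟩,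
      Polynomial.monic_X_pow_sub_C _ (Fact.out : p.Prime).ne_zero, ?_⟩
    rw [← Polynomial.aeval_def, map_sub, map_pow, Polynomial.aeval_X, Polynomial.aeval_C]
    exact sub_self _
  have hsep : IsSeparable E (M.x j) := by
    refine (Polynomial.separable_iff_derivative_ne_zero (minpoly.irreducible hint)).2 fun h0 => ?_
    obtain ⟨c, hc⟩ := minpoly.dvd E (M.x j) hF0
    apply h
    rw [← hder, hc, Polynomial.derivative_mul, h0]
    simp
  have hexp : ExpChar E p := ExpChar.prime Fact.out
  have hxj : M.x j ∈ E := by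
    have h1 := adjoin_simple_eq_adjoin_pow_expChar_of_isSeparable E K hsep p
    have h2 : M.x j ∈ E⟮M.x j⟯ := mem_adjoin_simple_self _ _
    have h3 : E⟮M.x j ^ p⟯ = ⊥ :=
      adjoin_simple_eq_bot_iff.2 (IntermediateField.mem_bot.2 ⟨⟨_, hpow⟩, rfl⟩)
    rw [h1, h3, IntermediateField.mem_bot] at h2
    obtain ⟨z, hz⟩ := h2
    rw [← hz]; exact z.2
  have hx : ∀ l, M.x l ∈ E := fun l => by
    by_cases hl : l = j
    · rw [hl]; exact hxj
    · exact hmem l hl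
  have haeval : ∀ G : MvPolynomial (Fin 3) k, aeval M.x G ∈ E := fun G => by
    have := comp_aeval_apply (fun l => (⟨M.x l, hx l⟩ : E)) (IsScalarTower.toAlgHom k E K) G
    have h2 : aeval M.x G = algebraMap E K (aeval (fun l => (⟨M.x l, hx l⟩ : E)) G) := this.symm
    rw [h2]; exact Subtype.mem _
  rw [eq_top_iff]
  intro u _
  obtain ⟨G, H, hH, e⟩ := M.exists_fraction u
  rw [eq_div_of_mul_eq hH e]
  exact E.div_mem (haeval G) (haeval H)

theorem exists_pow_eq_of_δ_eq_zero [IsAlgClosed k] {p : ℕ} [Fact p.Prime] [CharP K p]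
    (hF : IsSmoothCubic F) {f : K} (hf : M.δ f = 0) : ∃ r, r ^ p = f := by
  by_cases h2 : aeval M.x (pderiv 2 F) = 0
  · by_cases h1 : aeval M.x (pderiv 1 F) = 0
    · exfalso
      have h0 : aeval M.x (pderiv 0 F) = 0 := by
        simpa [h1, h2, M.x_zero] using M.sum_X_mul_pderiv hF
      have hz : ∀ i, pderiv i F = 0 := fun i => by
        have hi : (pderiv i F).IsHomogeneous 2 := hF.isHomogeneous.pderiv
        refine hF.dvd_eq_zero_of_lt (by norm_num) hi ((M.aeval_eq_zero_iff hi).1 ?_)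
        fin_cases i
        exacts [h0, h1, h2]
      obtain ⟨a, ha, h⟩ := hF.exists_eval_eq_zero
      exact ha (hF.eq_zero_of_singular a h fun i => by rw [hz i, map_zero])
    · exact exists_pow_eq_of_derivation_eq_zero M.δ
        (M.adjoin_x_eq_top hF (i := 2) (j := 1) (by decide) (by decide) (by decide) h1)
        (by rw [M.δ_two]; exact neg_ne_zero.2 h1) hf
  · exact exists_pow_eq_of_derivation_eq_zero M.δ
      (M.adjoin_x_eq_top hF (i := 1) (j := 2) (by decide) (by decide) (by decide) h2)
      (by rw [M.δ_one]; exact h2) hf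

end FunctionFieldModel

theorem forall_fin_three_of_symm {r : Fin 3 → Fin 3 → Prop} (hrefl : ∀ i, r i i)
    (hsymm : ∀ i j, r i j → r j i) (h01 : r 0 1) (h02 : r 0 2) (h12 : r 1 2) : ∀ i j, r i j := by
  intro i j
  fin_cases i <;> fin_cases j
  exacts [hrefl 0, h01, h02, hsymm _ _ h01, hrefl 1, h12, hsymm _ _ h02, hsymm _ _ h12, hrefl 2]

theorem Subring.exists_forall_eq_mul_of_mem_or_inv_mem {K : Type*} [Field K] (O : Subring K)
    (hO : ∀ u, u ∈ O ∨ u⁻¹ ∈ O) (f : Fin 3 → K) :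
    ∃ i, ∀ j, ∃ c ∈ O, f j = f i * c := by
  have htot : ∀ a b : K, (∃ c ∈ O, a = b * c) ∨ ∃ c ∈ O, b = a * c := by
    intro a b
    by_cases ha : a = 0
    · exact .inl ⟨0, O.zero_mem, by simp [ha]⟩
    by_cases hb : b = 0
    · exact .inr ⟨0, O.zero_mem, by simp [hb]⟩
    rcases hO (a / b) with h | h
    · exact .inl ⟨_, h, by field_simp⟩
    · exact .inr ⟨_, h, by field_simp⟩
  have htrans : ∀ {a b c : K}, (∃ r ∈ O, a = b * r) → (∃ r ∈ O, b = c * r) →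
      ∃ r ∈ O, a = c * r := by
    rintro a b c ⟨r, hr, rfl⟩ ⟨s, hs, rfl⟩
    exact ⟨s * r, O.mul_mem hs hr, mul_assoc _ _ _⟩
  have hrefl : ∀ a : K, ∃ r ∈ O, a = a * r := fun a => ⟨1, O.one_mem, (mul_one a).symm⟩
  obtain ⟨i, hi0, hi1⟩ : ∃ i, (∃ r ∈ O, f 0 = f i * r) ∧ ∃ r ∈ O, f 1 = f i * r := by
    rcases htot (f 0) (f 1) with h | h
    · exact ⟨1, h, hrefl _⟩
    · exact ⟨0, hrefl _, h⟩
  rcases htot (f i) (f 2) with h | h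
  · refine ⟨2, fun j => ?_⟩
    fin_cases j
    exacts [htrans hi0 h, htrans hi1 h, hrefl _]
  · refine ⟨i, fun j => ?_⟩
    fin_cases j
    exacts [hi0, hi1, h]

namespace FunctionFieldModel

variable {k : Type u} [Field k] {F : MvPolynomial (Fin 3) k} {K : Type u} [Field K] [Algebra k K]
  (M : FunctionFieldModel F K)

theorem exists_forall_eq_mul_mem_localRing [IsAlgClosed k] (hF : IsSmoothCubic F) {l : Fin 3}
    {P : Fin 3 → k} (hl : P l = 1) (hP : eval P F = 0) (f : Fin 3 → K) :
    ∃ i, ∀ j, ∃ c ∈ M.localRing l P, f j = f i * c :=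
  (M.localRing l P).toSubring.exists_forall_eq_mul_of_mem_or_inv_mem
    (M.mem_localRing_or_inv_mem hF hl hP) f

theorem inv_x_pow_mul_mem_localRing {m : ℕ} {u : K} (hu : u ∈ M.sections m) (l : Fin 3)
    (P : Fin 3 → k) : (M.x l)⁻¹ ^ m * u ∈ M.localRing l P := by
  obtain ⟨G, hG, rfl⟩ := M.mem_sections_natCast.1 hu
  rw [← M.aeval_t hG]
  exact M.aeval_t_mem_localRing l P G

/-- The cross product of a syzygy of `p`-th powers with its derivative is a section of a line
bundle of negative degree. -/
theorem cross_mem_sections [IsAlgClosed k] (hF : IsSmoothCubic F) {m Q r : ℕ} {A h : K}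
    {f : Fin 3 → K} (hA : ∀ i, A * f i ^ Q ∈ M.sections m)
    (hh : ∀ l, ∃ a b, h * M.x l ^ r = f a * M.δ (f b) - f b * M.δ (f a)) :
    A ^ 2 * h ^ Q ∈ M.sections (2 * m - (r * Q : ℕ)) := by
  refine M.mem_sections_of_forall_localRing hF fun l P hl hP => ?_
  have hxl := M.x_ne_zero hF l
  obtain ⟨i, hi⟩ := M.exists_forall_eq_mul_mem_localRing hF hl hP f
  choose g hg hfg using hi
  obtain ⟨a, b, hab⟩ := hh l
  have hw : g a * M.δ (g b) - g b * M.δ (g a) ∈ M.localRing l P :=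
    sub_mem (mul_mem (hg a) (M.δ_mem_localRing hF hl hP (hg b)))
      (mul_mem (hg b) (M.δ_mem_localRing hF hl hP (hg a)))
  have he : h * M.x l ^ r = f i ^ 2 * (g a * M.δ (g b) - g b * M.δ (g a)) := by
    rw [hab, hfg a, hfg b, Derivation.leibniz, Derivation.leibniz]
    simp only [smul_eq_mul]
    ring
  have hu := M.inv_x_pow_mul_mem_localRing (hA i) l P
  convert mul_mem (pow_mem hu 2) (pow_mem hw Q) using 1
  have hz : M.x l ^ (-(2 * (m : ℤ) - (r * Q : ℕ))) = (M.x l)⁻¹ ^ (2 * m) * M.x l ^ (r * Q) := by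
    rw [neg_sub, sub_eq_add_neg, zpow_add₀ hxl, zpow_natCast, zpow_neg, inv_pow, mul_comm,
      ← zpow_natCast (M.x l) (2 * m)]
    push_cast
    rfl
  calc _ = A ^ 2 * (M.x l)⁻¹ ^ (2 * m) * (h * M.x l ^ r) ^ Q := by rw [hz, pow_mul (M.x l) r]; ring
    _ = _ := by rw [he, mul_comm 2 m, pow_mul _ m, mul_pow (f i ^ 2)]; ring

theorem descent_step [IsAlgClosed k] {p : ℕ} [Fact p.Prime] [CharP K p]
    (hF : IsSmoothCubic F) {m Q r : ℕ} (hQ : 2 * m < r * p * Q) {A : K} (hA0 : A ≠ 0)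
    {f : Fin 3 → K} (hA : ∀ i, A * f i ^ Q ∈ M.sections m) {j : Fin 3} (hj : f j = 1)
    (hsum : ∑ i, f i * M.x i ^ (r * p) = 0) :
    ∃ g : Fin 3 → K, g j = 1 ∧ (∀ i, A * g i ^ (p * Q) ∈ M.sections m) ∧
      ∑ i, g i * M.x i ^ r = 0 := by
  have hpp := (Fact.out : p.Prime)
  have hpow : ∀ z : K, M.δ (z ^ (r * p)) = 0 := fun z => by
    rw [Derivation.leibniz_pow, ← Nat.cast_smul_eq_nsmul K, Nat.cast_mul, CharP.cast_eq_zero K p,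
      mul_zero, zero_smul]
  have hdsum : ∑ i, M.δ (f i) * M.x i ^ (r * p) = 0 := by
    have := congrArg M.δ hsum
    simpa [Derivation.leibniz, hpow, mul_comm] using this
  rw [Fin.sum_univ_three, M.x_zero, one_pow, mul_one] at hsum hdsum
  set h := f 1 * M.δ (f 2) - f 2 * M.δ (f 1) with hh
  have h0 : h * M.x 0 ^ (r * p) = f 1 * M.δ (f 2) - f 2 * M.δ (f 1) := by simp [hh, M.x_zero]
  have h1 : h * M.x 1 ^ (r * p) = f 2 * M.δ (f 0) - f 0 * M.δ (f 2) := by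
    linear_combination M.δ (f 2) * hsum - f 2 * hdsum
  have h2 : h * M.x 2 ^ (r * p) = f 0 * M.δ (f 1) - f 1 * M.δ (f 0) := by
    linear_combination f 1 * hdsum - M.δ (f 1) * hsum
  have hz : h = 0 := by
    have hmem : A ^ 2 * h ^ Q ∈ M.sections _ := M.cross_mem_sections hF (r := r * p) hA (by
      intro l
      fin_cases l
      exacts [⟨1, 2, h0⟩, ⟨2, 0, h1⟩, ⟨0, 1, h2⟩])
    have := M.eq_zero_of_mem_sections_of_neg (by
      have : ((2 * m : ℕ) : ℤ) < (r * p * Q : ℕ) := by exact_mod_cast hQ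
      push_cast at this ⊢
      linarith) hmem
    exact eq_zero_of_pow_eq_zero ((mul_eq_zero.1 this).resolve_left (pow_ne_zero _ hA0))
  rw [hz, zero_mul] at h0 h1 h2
  have hδ : ∀ i, M.δ (f i) = 0 := by
    have hcross : ∀ a b, f a * M.δ (f b) = f b * M.δ (f a) :=
      forall_fin_three_of_symm (fun _ => rfl) (fun _ _ h => h.symm) (sub_eq_zero.1 h2.symm)
        (sub_eq_zero.1 h1.symm).symm (sub_eq_zero.1 h0.symm)
    intro i
    have := hcross j i
    rwa [hj, one_mul, Derivation.map_one_eq_zero, mul_zero] at this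
  choose g hg using fun i => M.exists_pow_eq_of_δ_eq_zero (p := p) hF (hδ i)
  refine ⟨g, ?_, fun i => by rw [pow_mul, hg]; exact hA i, ?_⟩
  · apply frobenius_inj K p
    rw [frobenius_def, hg, hj, map_one]
  · apply frobenius_inj K p
    rw [map_sum, map_zero, Fin.sum_univ_three]
    simp only [frobenius_def, mul_pow, hg, ← pow_mul]
    rw [M.x_zero, one_pow, mul_one]
    exact hsum

theorem exists_descent [IsAlgClosed k] {p : ℕ} [Fact p.Prime] [CharP K p]
    (hF : IsSmoothCubic F) {m e : ℕ} (hm : 2 * m < p ^ e) {w : Fin 3 → K} (hw0 : w ≠ 0)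
    (hw : ∀ i, w i ∈ M.sections m) (hsum : ∑ i, w i * M.x i ^ p ^ e = 0) :
    ∃ (A : K) (f : Fin 3 → K) (j : Fin 3), A ≠ 0 ∧ f j = 1 ∧
      (∀ i, A * f i ^ p ^ e ∈ M.sections m) ∧ ∑ i, f i * M.x i = 0 := by
  have key : ∀ e' ≤ e, ∃ (A : K) (f : Fin 3 → K) (j : Fin 3), A ≠ 0 ∧ f j = 1 ∧
      (∀ i, A * f i ^ p ^ e' ∈ M.sections m) ∧ ∑ i, f i * M.x i ^ p ^ (e - e') = 0 := by
    intro e' he'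
    induction e' with
    | zero =>
      obtain ⟨j, hj⟩ := Function.ne_iff.1 hw0
      refine ⟨w j, fun i => (w j)⁻¹ * w i, j, hj, inv_mul_cancel₀ hj, fun i => ?_, ?_⟩
      · rw [pow_zero, pow_one, mul_inv_cancel_left₀ hj]
        exact hw i
      · simp only [mul_assoc]
        rw [← Finset.mul_sum, Nat.sub_zero, hsum, mul_zero]
    | succ e' ih =>
      obtain ⟨A, f, j, hA0, hj, hA, hs⟩ := ih (by omega)
      have he : e - e' = e - (e' + 1) + 1 := by omega
      rw [he, pow_succ] at hs
      obtain ⟨g, hgj, hg, hgs⟩ := M.descent_step hF (by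
        rw [← pow_succ, ← he, ← pow_add, Nat.sub_add_cancel (by omega)]
        exact hm) hA0 hA hj hs
      exact ⟨A, g, j, hA0, hgj, by rwa [pow_succ'], hgs⟩
  simpa using key e le_rfl

end FunctionFieldModel

theorem Polynomial.exists_sum_mul_eq_one {k : Type*} [Field k] [IsAlgClosed k]
    {N : Fin 3 → Polynomial k} (h : ∀ a, ∃ i, (N i).eval a ≠ 0) :
    ∃ s : Fin 3 → Polynomial k, ∑ i, s i * N i = 1 := by
  rw [← Ideal.mem_span_range_iff_exists_fun, ← Ideal.eq_top_iff_one]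
  by_contra hne
  set d := Submodule.IsPrincipal.generator (Ideal.span (Set.range N)) with hd
  have hspan : Ideal.span {d} = Ideal.span (Set.range N) := Ideal.span_singleton_generator _
  have hdvd : ∀ i, d ∣ N i := fun i => by
    rw [← Ideal.mem_span_singleton, hspan]
    exact Ideal.subset_span ⟨i, rfl⟩
  have hdeg : d.degree ≠ 0 := fun h0 => hne (by
    rw [← hspan, Ideal.span_singleton_eq_top, Polynomial.isUnit_iff_degree_eq_zero, h0])
  obtain ⟨a, ha⟩ := IsAlgClosed.exists_root d hdeg
  obtain ⟨i, hi⟩ := h a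
  exact hi (Polynomial.eval_eq_zero_of_dvd_of_eval_eq_zero (hdvd i) ha)

theorem Polynomial.exists_eq_mul_of_cross_eq_zero {k : Type*} [Field k] [IsAlgClosed k]
    {N V : Fin 3 → Polynomial k} (h : ∀ a, ∃ i, (N i).eval a ≠ 0)
    (hV : ∀ i j, V i * N j = V j * N i) : ∃ w, ∀ i, V i = w * N i := by
  obtain ⟨s, hs⟩ := Polynomial.exists_sum_mul_eq_one h
  refine ⟨∑ i, s i * V i, fun j => ?_⟩
  calc V j = (∑ i, s i * N i) * V j := by rw [hs, one_mul]
    _ = _ := by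
      rw [Finset.sum_mul, Finset.sum_mul]
      exact Finset.sum_congr rfl fun i _ => by rw [mul_assoc, mul_assoc, hV i j, mul_comm (N i)]

namespace IsSmoothCubic

variable {k : Type*} [Field k] [IsAlgClosed k] {F : MvPolynomial (Fin 3) k}

theorem derivative_eq_zero_of_aeval_eq_zero (hF : IsSmoothCubic F) {P : Fin 3 → Polynomial k}
    (h0 : aeval P F = 0) (hroot : ∀ a, ∃ i, (P i).eval a ≠ 0) {n : ℕ}
    (hn : ∀ i, (P i).natDegree ≤ n) {l : Fin 3} (hl : (P l).coeff n ≠ 0) (hn0 : n ≠ 0) :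
    ∀ i, Polynomial.derivative (P i) = 0 := by
  let N : Fin 3 → Polynomial k := fun i => aeval P (pderiv i F)
  let V : Fin 3 → Polynomial k :=
    ![P 1 * Polynomial.derivative (P 2) - P 2 * Polynomial.derivative (P 1),
      P 2 * Polynomial.derivative (P 0) - P 0 * Polynomial.derivative (P 2),
      P 0 * Polynomial.derivative (P 1) - P 1 * Polynomial.derivative (P 0)]
  have hV0 : V 0 = P 1 * Polynomial.derivative (P 2) - P 2 * Polynomial.derivative (P 1) := rfl
  have hV1 : V 1 = P 2 * Polynomial.derivative (P 0) - P 0 * Polynomial.derivative (P 2) := rfl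
  have hV2 : V 2 = P 0 * Polynomial.derivative (P 1) - P 1 * Polynomial.derivative (P 0) := rfl
  have hPN : P 0 * N 0 + P 1 * N 1 + P 2 * N 2 = 0 := by
    have h := congrArg (aeval P) hF.isHomogeneous.sum_X_mul_pderiv
    rw [map_nsmul, h0, Fin.sum_univ_three] at h
    simpa using h
  have hdPN : N 0 * Polynomial.derivative (P 0) + N 1 * Polynomial.derivative (P 1) +
      N 2 * Polynomial.derivative (P 2) = 0 := by
    have h := derivation_aeval_eq_sum (Polynomial.derivative' (R := k)) P F
    rw [h0, map_zero, Fin.sum_univ_three] at h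
    exact h.symm
  have hNroot : ∀ a, ∃ i, (N i).eval a ≠ 0 := by
    intro a
    by_contra! hc
    have heval : ∀ G : MvPolynomial (Fin 3) k,
        (aeval P G).eval a = eval (fun i => (P i).eval a) G := fun G => by
      have := comp_aeval_apply P (Polynomial.aeval (R := k) a) G
      simpa [Polynomial.coe_aeval_eq_eval, MvPolynomial.coe_aeval_eq_eval] using this
    obtain ⟨i, hi⟩ := hroot a
    exact hi (congrFun (hF.eq_zero_of_singular (fun i => (P i).eval a)
      (by rw [← heval, h0, Polynomial.eval_zero]) fun i => by rw [← heval, hc]) i)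
  have hcross : ∀ i j, V i * N j = V j * N i := by
    have h01 : V 0 * N 1 = V 1 * N 0 := by
      rw [hV0, hV1]
      linear_combination Polynomial.derivative (P 2) * hPN - P 2 * hdPN
    have h02 : V 0 * N 2 = V 2 * N 0 := by
      rw [hV0, hV2]
      linear_combination P 1 * hdPN - Polynomial.derivative (P 1) * hPN
    have h12 : V 1 * N 2 = V 2 * N 1 := by
      rw [hV1, hV2]
      linear_combination Polynomial.derivative (P 0) * hPN - P 0 * hdPN
    exact forall_fin_three_of_symm (fun _ => rfl) (fun _ _ h => h.symm) h01 h02 h12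
  obtain ⟨w, hw⟩ := Polynomial.exists_eq_mul_of_cross_eq_zero hNroot hcross
  obtain ⟨i, hi⟩ : ∃ i, (N i).coeff (2 * n) ≠ 0 := by
    by_contra! hc
    refine hl (congrFun (hF.eq_zero_of_singular (fun i => (P i).coeff n) ?_ fun i => ?_) l)
    · rw [← (natDegree_coeff_aeval_of_isHomogeneous hF.isHomogeneous P hn).2, h0,
        Polynomial.coeff_zero]
    · have hp : (pderiv i F).IsHomogeneous 2 := hF.isHomogeneous.pderiv
      rw [← (natDegree_coeff_aeval_of_isHomogeneous hp P hn).2]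
      exact hc i
  have hd : ∀ i, (Polynomial.derivative (P i)).natDegree ≤ n - 1 := fun i =>
    (Polynomial.natDegree_derivative_le _).trans (Nat.sub_le_sub_right (hn i) 1)
  have hVdeg : ∀ i, (V i).natDegree ≤ n + (n - 1) := by
    have hmul : ∀ a b, (P a * Polynomial.derivative (P b)).natDegree ≤ n + (n - 1) := fun a b =>
      Polynomial.natDegree_mul_le_of_le (hn a) (hd b)
    have hsub : ∀ a b, (P a * Polynomial.derivative (P b) -
        P b * Polynomial.derivative (P a)).natDegree ≤ n + (n - 1) := fun a b =>
      (Polynomial.natDegree_sub_le _ _).trans (max_le (hmul a b) (hmul b a))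
    intro i
    fin_cases i
    exacts [hsub 1 2, hsub 2 0, hsub 0 1]
  have hw0 : w = 0 := by
    by_contra hne
    have h1 := hVdeg i
    rw [hw i, Polynomial.natDegree_mul hne (fun h => hi (by rw [h, Polynomial.coeff_zero]))] at h1
    have h2 := Polynomial.le_natDegree_of_ne_zero hi
    omega
  have hVz : ∀ i, V i = 0 := fun i => by rw [hw, hw0, zero_mul]
  have hcross' : ∀ i j, Polynomial.derivative (P i) * P j = Polynomial.derivative (P j) * P i := by
    have h12 := (hVz 0).symm.trans hV0
    have h20 := (hVz 1).symm.trans hV1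
    have h01 := (hVz 2).symm.trans hV2
    refine forall_fin_three_of_symm (fun _ => rfl) (fun _ _ h => h.symm) ?_ ?_ ?_
    · linear_combination h01
    · linear_combination -h20
    · linear_combination h12
  obtain ⟨w', hw'⟩ := Polynomial.exists_eq_mul_of_cross_eq_zero hroot hcross'
  have hw0' : w' = 0 := by
    by_contra hne
    have h1 := hd l
    rw [hw' l, Polynomial.natDegree_mul hne (fun h => hl (by rw [h, Polynomial.coeff_zero]))] at h1
    have h2 := Polynomial.le_natDegree_of_ne_zero hl
    omega
  exact fun i => by rw [hw', hw0', zero_mul]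

/-- A smooth plane cubic has no nonconstant rational parametrization. -/
theorem exists_eq_mul_C_of_aeval_eq_zero {p : ℕ} [Fact p.Prime] [CharP k p]
    (hF : IsSmoothCubic F) {P : Fin 3 → Polynomial k} (hP : P ≠ 0) (h0 : aeval P F = 0) :
    ∃ (G : Polynomial k) (c : Fin 3 → k), ∀ i, P i = G * Polynomial.C (c i) := by
  obtain ⟨n, hn⟩ : ∃ n, ∀ i, (P i).natDegree ≤ n :=
    ⟨Finset.univ.sup fun i => (P i).natDegree, fun i =>
      Finset.le_sup (f := fun i => (P i).natDegree) (Finset.mem_univ i)⟩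
  induction n using Nat.strong_induction_on generalizing P with
  | _ n ih =>
  rcases Nat.eq_zero_or_pos n with rfl | hpos
  · exact ⟨1, fun i => (P i).coeff 0, fun i => by
      rw [one_mul]; exact Polynomial.eq_C_of_natDegree_le_zero (hn i)⟩
  by_cases hlead : ∀ i, (P i).coeff n = 0
  · refine ih (n - 1) (by omega) hP h0 fun i => ?_
    rcases (hn i).lt_or_eq with h | h
    · omega
    · have := hlead i
      rw [← h, Polynomial.coeff_natDegree, Polynomial.leadingCoeff_eq_zero] at this
      rw [this]; simp
  push Not at hlead
  obtain ⟨l, hl⟩ := hlead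
  by_cases hroot : ∀ a, ∃ i, (P i).eval a ≠ 0
  · have hder := hF.derivative_eq_zero_of_aeval_eq_zero h0 hroot hn hl hpos.ne'
    have hexp : ∀ i, Polynomial.expand k p (Polynomial.contract p (P i)) = P i := fun i =>
      Polynomial.expand_contract p (hder i) (Fact.out : p.Prime).ne_zero
    have hpp := (Fact.out : p.Prime)
    obtain ⟨G, c, hG⟩ := ih (n - 1) (by omega) (P := fun i => Polynomial.contract p (P i)) (by
        intro h
        apply hP
        ext1 i
        rw [← hexp i, congrFun h i]; simp) (by
        apply Polynomial.expand_injective hpp.pos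
        rw [comp_aeval_apply]
        simp only [hexp, map_zero, h0]) (fun i => by
        have h1 := Polynomial.natDegree_expand p (Polynomial.contract p (P i))
        rw [hexp] at h1
        have h2 := hn i
        have h3 := hpp.two_le
        nlinarith [Nat.sub_add_cancel hpos])
    refine ⟨Polynomial.expand k p G, c, fun i => ?_⟩
    rw [← hexp i, hG i]
    simp
  · push Not at hroot
    obtain ⟨a, ha⟩ := hroot
    choose Q hQ using fun i => Polynomial.dvd_iff_isRoot.2 (ha i)
    have hX : (Polynomial.X - Polynomial.C a : Polynomial k) ≠ 0 := Polynomial.X_sub_C_ne_zero a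
    have hPQ : P = fun i => (Polynomial.X - Polynomial.C a) * Q i := funext hQ
    obtain ⟨G, c, hG⟩ := ih (n - 1) (by omega) (P := Q) (by
        rintro rfl
        apply hP
        rw [hPQ]; ext1 i; simp) (by
        rw [hPQ, aeval_smul_of_isHomogeneous hF.isHomogeneous] at h0
        exact (mul_eq_zero.1 h0).resolve_left (pow_ne_zero _ hX)) (fun i => by
        by_cases h : Q i = 0
        · rw [h]; simp
        · have := hn i
          rw [hQ, Polynomial.natDegree_mul hX h, Polynomial.natDegree_X_sub_C] at this
          omega)
    exact ⟨(Polynomial.X - Polynomial.C a) * G, c, fun i => by rw [hQ, hG, mul_assoc]⟩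

end IsSmoothCubic

instance finite_homogeneousSubmodule {k : Type*} [Field k] (n : ℕ) :
    Module.Finite k (homogeneousSubmodule (Fin 3) k n) :=
  Module.finite_of_finrank_pos (by
    rw [finrank_homogeneousSubmodule]; exact Nat.choose_pos (by omega))

namespace FunctionFieldModel

variable {k : Type u} [Field k] {F : MvPolynomial (Fin 3) k} {K : Type u} [Field K] [Algebra k K]
  (M : FunctionFieldModel F K)

instance finite_sections (n : ℕ) : Module.Finite k (M.sections n) :=
  inferInstanceAs (Module.Finite k
    ((homogeneousSubmodule (Fin 3) k n).map (aeval M.x).toLinearMap))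

theorem finrank_sections_le (hF : IsSmoothCubic F) {n : ℕ} (hn : 1 ≤ n) :
    Module.finrank k (M.sections n) ≤ 3 * n := by
  let φ : homogeneousSubmodule (Fin 3) k n →ₗ[k] K :=
    (aeval M.x).toLinearMap.comp (Submodule.subtype _)
  have hrange : M.sections n = LinearMap.range φ := by
    rw [LinearMap.range_comp, Submodule.range_subtype]; rfl
  have hsum := φ.finrank_range_add_finrank_ker
  rw [← hrange, finrank_homogeneousSubmodule] at hsum
  rcases lt_or_ge n 3 with h3 | h3
  · have : (n + 2).choose 2 ≤ 3 * n := by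
      clear * - hn h3
      interval_cases n <;> decide
    omega
  obtain ⟨d, rfl⟩ := Nat.exists_eq_add_of_le h3
  let ψ : homogeneousSubmodule (Fin 3) k d →ₗ[k] LinearMap.ker φ :=
    LinearMap.codRestrict _ (((LinearMap.mulLeft k F).domRestrict _).codRestrict _
      fun G => hF.isHomogeneous.mul G.2) fun G => by
        rw [LinearMap.mem_ker]
        exact (M.aeval_eq_zero_iff (hF.isHomogeneous.mul G.2)).2 (dvd_mul_right _ _)
  have hψ : Function.Injective ψ := fun G H h => by
    have h' : F * (G : MvPolynomial (Fin 3) k) = F * H :=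
      congrArg (fun z : LinearMap.ker φ => (z.1 : MvPolynomial (Fin 3) k)) h
    exact Subtype.ext (mul_left_cancel₀ hF.ne_zero h')
  have hle := LinearMap.finrank_le_finrank_of_injective hψ
  rw [finrank_homogeneousSubmodule] at hle
  have h1 : (3 + d + 2).choose 2 = (d + 2).choose 2 + 3 * (3 + d) := by
    rw [Nat.choose_two_right, Nat.choose_two_right]
    have e1 : (3 + d + 2) * (3 + d + 2 - 1) = (d + 2) * (d + 2 - 1) + 2 * (3 * (3 + d)) := by
      simp only [show 3 + d + 2 - 1 = d + 4 by omega, show d + 2 - 1 = d + 1 by omega]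
      ring
    rw [e1, Nat.add_mul_div_left _ _ two_pos]
  omega

theorem eq_zero_of_sum_algebraMap_mul_eq_zero (hF : IsSmoothCubic F) {c : Fin 3 → k}
    (h : ∑ i, algebraMap k K (c i) * M.x i = 0) : c = 0 := by
  have hG : (∑ i, C (c i) * X i : MvPolynomial (Fin 3) k).IsHomogeneous 1 :=
    IsHomogeneous.sum _ _ _ fun i _ => by
      simpa using (isHomogeneous_C (Fin 3) (c i)).mul (isHomogeneous_X k i)
  have h0 : (∑ i, C (c i) * X i : MvPolynomial (Fin 3) k) = 0 :=
    hF.dvd_eq_zero_of_lt (by norm_num) hG ((M.aeval_eq_zero_iff hG).1 (by simpa using h))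
  ext i
  have := congrArg (eval (Pi.single i 1)) h0
  simpa [Pi.single_apply] using this

theorem mul_pow_mem_sections [IsAlgClosed k] (hF : IsSmoothCubic F) {m q : ℕ} {A f : K}
    (hA : A ∈ M.sections m) (hAf : A * f ^ q ∈ M.sections m) {n : ℕ} (hn : n ≤ q) :
    A * f ^ n ∈ M.sections m := by
  refine M.mem_sections_of_forall_localRing hF fun l P hl hP => ?_
  rw [zpow_neg, zpow_natCast, ← inv_pow, mul_comm]
  have h1 := M.inv_x_pow_mul_mem_localRing hA l P
  have h2 := M.inv_x_pow_mul_mem_localRing hAf l P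
  by_cases hf : f = 0
  · rcases n with _ | n
    · simpa using h1
    · simp [hf]
  rcases M.mem_localRing_or_inv_mem hF hl hP f with h | h
  · convert mul_mem h1 (pow_mem h n) using 1
    ring
  · convert mul_mem h2 (pow_mem h (q - n)) using 1
    obtain ⟨d, rfl⟩ := Nat.exists_eq_add_of_le hn
    have e : f ^ d * f⁻¹ ^ d = 1 := by rw [← mul_pow, mul_inv_cancel₀ hf, one_pow]
    rw [Nat.add_sub_cancel_left, pow_add]
    generalize f⁻¹ = g at e
    linear_combination -((M.x l)⁻¹ ^ m * A * f ^ n) * e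

theorem exists_forall_x_mul_aeval_ne [IsAlgClosed k] {p : ℕ} [Fact p.Prime] [CharP k p]
    (hF : IsSmoothCubic F) {f : K} (hf : Transcendental k f) :
    ∃ a, ∀ N D : Polynomial k, D ≠ 0 →
      M.x a * Polynomial.aeval f D ≠ Polynomial.aeval f N := by
  by_contra! hc
  choose N D hD hND using hc
  have hinj := transcendental_iff_injective.1 hf
  let D' := D 1 * D 2
  let P : Fin 3 → Polynomial k := ![D', N 1 * D 2, N 2 * D 1]
  have hD' : D' ≠ 0 := mul_ne_zero (hD 1) (hD 2)
  have hd : Polynomial.aeval f D' ≠ 0 := fun h => hD' (hinj (by rw [h, map_zero]))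
  have hP : ∀ i, Polynomial.aeval f (P i) = Polynomial.aeval f D' * M.x i := by
    intro i
    fin_cases i
    · simp [P, M.x_zero]
    · simp [P, D', ← hND]; ring
    · simp [P, D', ← hND]; ring
  have h0 : aeval P F = 0 := by
    apply hinj
    rw [comp_aeval_apply, map_zero]
    simp only [hP]
    rw [aeval_smul_of_isHomogeneous hF.isHomogeneous,
      (M.aeval_eq_zero_iff hF.isHomogeneous).2 dvd_rfl, mul_zero]
  obtain ⟨G, c, hG⟩ := hF.exists_eq_mul_C_of_aeval_eq_zero (p := p)
    (fun h => hD' (congrFun h 0)) h0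
  have hgc : ∀ i, Polynomial.aeval f D' * M.x i = Polynomial.aeval f G * algebraMap k K (c i) :=
    fun i => by rw [← hP, hG, map_mul, Polynomial.aeval_C]
  have h00 := hgc 0
  rw [M.x_zero, mul_one] at h00
  have hg : Polynomial.aeval f G ≠ 0 := fun h => hd (by rw [h00, h, zero_mul])
  have hc0 : c 0 ≠ 0 := fun h => hd (by rw [h00, h, map_zero, mul_zero])
  have hrel : ∑ i, algebraMap k K ((![-c 1, c 0, 0] : Fin 3 → k) i) * M.x i = 0 := by
    have h1 := hgc 1
    rw [h00, mul_assoc] at h1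
    have h2 := mul_left_cancel₀ hg h1
    simp [Fin.sum_univ_three, M.x_zero, h2]
  exact hc0 (congrFun (M.eq_zero_of_sum_algebraMap_mul_eq_zero hF hrel) 1)

theorem lt_two_mul_of_transcendental [IsAlgClosed k] {p : ℕ} [Fact p.Prime] [CharP k p]
    (hF : IsSmoothCubic F) {m q : ℕ} {A f : K} (hA0 : A ≠ 0) (hA : A ∈ M.sections m)
    (hAf : A * f ^ q ∈ M.sections m) (hf : Transcendental k f) :
    2 * (q + 1) ≤ 3 * (m + 1) := by
  obtain ⟨a, ha⟩ := M.exists_forall_x_mul_aeval_ne (p := p) hF hf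
  have hinj := transcendental_iff_injective.1 hf
  have hmem : ∀ P ∈ Polynomial.degreeLT k (q + 1), A * Polynomial.aeval f P ∈ M.sections m := by
    intro P hP
    rw [Polynomial.mem_degreeLT] at hP
    have hP' : P.natDegree < q + 1 := by
      by_cases h : P = 0
      · rw [h, Polynomial.natDegree_zero]; omega
      · exact (Polynomial.natDegree_lt_iff_degree_lt h).2 (by exact_mod_cast hP)
    rw [Polynomial.aeval_eq_sum_range' hP', Finset.mul_sum]
    refine sum_mem fun n hn => ?_
    rw [mul_smul_comm]
    exact Submodule.smul_mem _ _
      (M.mul_pow_mem_sections hF hA hAf (Nat.lt_succ_iff.1 (Finset.mem_range.1 hn)))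
  have hmemX : ∀ (i : Fin 3) {u : K}, u ∈ M.sections m → u * M.x i ∈ M.sections (m + 1 : ℕ) := by
    intro i u hu
    have := M.mul_aeval_mem_sections (isHomogeneous_X k i) hu
    rwa [aeval_X] at this
  let V := Polynomial.degreeLT k (q + 1)
  let μ : V →ₗ[k] K := (LinearMap.mulLeft k A).comp
    ((Polynomial.aeval f).toLinearMap.comp (Submodule.subtype V))
  have hμ : ∀ P : V, μ P = A * Polynomial.aeval f (P : Polynomial k) := fun _ => rfl
  let Φ : V × V →ₗ[k] M.sections (m + 1 : ℕ) := LinearMap.codRestrict _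
    (((LinearMap.mulRight k (M.x 0)).comp μ).coprod ((LinearMap.mulRight k (M.x a)).comp μ))
    fun ⟨P, Q⟩ => add_mem (hmemX 0 (hmem P P.2)) (hmemX a (hmem Q Q.2))
  have hΦ : Function.Injective Φ := by
    rw [injective_iff_map_eq_zero]
    rintro ⟨P, Q⟩ h
    have h1 : μ P * M.x 0 + μ Q * M.x a = 0 := congrArg Subtype.val h
    rw [hμ, hμ, M.x_zero, mul_one, mul_assoc, ← mul_add] at h1
    have h2 := (mul_eq_zero.1 h1).resolve_left hA0
    have hQ : (Q : Polynomial k) = 0 := by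
      by_contra hQ
      refine ha (-P) Q hQ ?_
      rw [map_neg]
      linear_combination h2
    have hP : (P : Polynomial k) = 0 := by
      apply hinj
      rw [map_zero]
      rw [hQ, map_zero, zero_mul, add_zero] at h2
      exact h2
    exact Prod.ext (Subtype.ext hP) (Subtype.ext hQ)
  have hV : Module.finrank k V = q + 1 := by
    rw [(Polynomial.degreeLTEquiv k (q + 1)).finrank_eq, Module.finrank_fin_fun]
  have : Module.Finite k V := Module.finite_of_finrank_pos (by omega)
  have hle := LinearMap.finrank_le_finrank_of_injective hΦ
  rw [Module.finrank_prod, hV] at hle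
  have := M.finrank_sections_le hF (n := m + 1) (by omega)
  omega

theorem eq_zero_of_sum_mul_pow_eq_zero [IsAlgClosed k] {p : ℕ} [Fact p.Prime] [CharP k p]
    (hF : IsSmoothCubic F) {m e : ℕ} (hm : 2 * m < p ^ e) {w : Fin 3 → K}
    (hw : ∀ i, w i ∈ M.sections m) (hsum : ∑ i, w i * M.x i ^ p ^ e = 0) : w = 0 := by
  have : CharP K p := charP_of_injective_algebraMap (algebraMap k K).injective p
  by_contra hw0
  obtain ⟨A, f, j, hA0, hj, hA, hs⟩ := M.exists_descent hF hm hw0 hw hsum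
  have htr : ∃ i, Transcendental k (f i) := by
    by_contra! hc
    have hconst : ∀ i, ∃ c : k, algebraMap k K c = f i := fun i => by
      have hint : IsIntegral k (f i) := (not_not.1 (hc i)).isIntegral
      exact minpoly.mem_range_of_degree_eq_one k (f i)
        (IsAlgClosed.degree_eq_one_of_irreducible k (minpoly.irreducible hint))
    choose c hc using hconst
    have :=
      congrFun (M.eq_zero_of_sum_algebraMap_mul_eq_zero hF (c := c) (by simpa [hc] using hs)) j
    have h1 := hc j
    rw [this, hj] at h1
    simp at h1
  obtain ⟨i, hi⟩ := htr
  have hAm : A ∈ M.sections m := by simpa [hj] using hA j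
  have := M.lt_two_mul_of_transcendental (p := p) hF hA0 hAm (hA i) hi
  omega

end FunctionFieldModel

/-- The Frobenius power `(X₀^q, X₁^q, X₂^q)` of the irrelevant ideal. -/
noncomputable def frobeniusPower (k : Type*) [Field k] (q : ℕ) : Ideal (MvPolynomial (Fin 3) k) :=
  Ideal.span (Set.range fun i => X i ^ q)

section

variable {k : Type u} [Field k] {F : MvPolynomial (Fin 3) k} {q : ℕ}

theorem mem_frobeniusPower {G : MvPolynomial (Fin 3) k} :
    G ∈ frobeniusPower k q ↔ ∀ α, coeff α G ≠ 0 → ∃ i, q ≤ α i := by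
  have h : (Set.range fun i : Fin 3 => (X i ^ q : MvPolynomial (Fin 3) k)) =
      (fun s => monomial s 1) '' Set.range fun i : Fin 3 => Finsupp.single i q := by
    rw [← Set.range_comp]
    exact congrArg Set.range (funext fun i => X_pow_eq_monomial)
  rw [frobeniusPower, h, mem_ideal_span_monomial_image]
  simp [mem_support_iff]

theorem homogeneousComponent_mem_frobeniusPower {G : MvPolynomial (Fin 3) k}
    (hG : G ∈ frobeniusPower k q) (n : ℕ) : homogeneousComponent n G ∈ frobeniusPower k q := by
  rw [mem_frobeniusPower] at hG ⊢
  intro α hα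
  rw [coeff_homogeneousComponent] at hα
  exact hG α fun h => hα (by rw [h, ite_self])

theorem exists_isHomogeneous_sum_mul_X_pow {G : MvPolynomial (Fin 3) k} {n : ℕ}
    (hG : G.IsHomogeneous n) (h : G ∈ frobeniusPower k q) :
    G = 0 ∨ ∃ (m : ℕ) (a : Fin 3 → MvPolynomial (Fin 3) k), q + m = n ∧
      (∀ i, (a i).IsHomogeneous m) ∧ ∑ i, a i * X i ^ q = G := by
  obtain ⟨a, ha⟩ := Ideal.mem_span_range_iff_exists_fun.1 h
  have hX : ∀ i, (X i ^ q : MvPolynomial (Fin 3) k).IsHomogeneous q := fun i => by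
    simpa using (isHomogeneous_X k i).pow q
  have hn : homogeneousComponent n G = G := by
    rw [homogeneousComponent_of_mem hG, if_pos rfl]
  rcases lt_or_ge n q with hlt | hle
  · left
    rw [← hn, ← ha, map_sum]
    exact Finset.sum_eq_zero fun i _ => by
      rw [mul_comm, homogeneousComponent_mul_eq_zero_of_lt (hX i) hlt]
  · right
    obtain ⟨m, rfl⟩ := Nat.exists_eq_add_of_le hle
    refine ⟨m, fun i => homogeneousComponent m (a i), rfl,
      fun i => homogeneousComponent_isHomogeneous _ _, ?_⟩
    rw [← hn, ← ha, map_sum]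
    exact Finset.sum_congr rfl fun i _ => by
      rw [mul_comm (a i), homogeneousComponent_mul_of_isHomogeneous (hX i), mul_comm]

theorem IsSmoothCubic.mem_frobeniusPower_of_mul_mem [IsAlgClosed k] {p : ℕ} [Fact p.Prime]
    [CharP k p] (hF : IsSmoothCubic F) {e d : ℕ} (hd : 2 * (3 + d) < 3 * p ^ e)
    {g : MvPolynomial (Fin 3) k} (hg : g.IsHomogeneous d) (h : F * g ∈ frobeniusPower k (p ^ e)) :
    g ∈ frobeniusPower k (p ^ e) := by
  obtain ⟨K, _, _, ⟨M⟩⟩ := hF.exists_functionFieldModel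
  rcases exists_isHomogeneous_sum_mul_X_pow (hF.isHomogeneous.mul hg) h with h0 | ⟨m, a, hm, ha, hs⟩
  · rw [(mul_eq_zero.1 h0).resolve_left hF.ne_zero]
    exact zero_mem _
  · have hw := M.eq_zero_of_sum_mul_pow_eq_zero (p := p) hF (m := m) (e := e) (by omega)
      (w := fun i => aeval M.x (a i)) (fun i => M.aeval_mem_sections (ha i)) (by
        have := congrArg (aeval M.x) hs
        rw [map_mul, (M.aeval_eq_zero_iff hF.isHomogeneous).2 dvd_rfl, zero_mul] at this
        simpa using this)
    choose b hb using fun i => (M.aeval_eq_zero_iff (ha i)).1 (congrFun hw i)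
    have hgb : g = ∑ i, b i * X i ^ p ^ e := by
      apply mul_left_cancel₀ hF.ne_zero
      rw [← hs, Finset.mul_sum]
      exact Finset.sum_congr rfl fun i _ => by rw [hb i, mul_assoc]
    rw [hgb]
    exact Ideal.mem_span_range_iff_exists_fun.2 ⟨b, rfl⟩

/-- In high degrees, multiplication by a smooth cubic is surjective modulo the Frobenius power. -/
theorem IsSmoothCubic.mem_span_sup_frobeniusPower [IsAlgClosed k] {p : ℕ} [Fact p.Prime]
    [CharP k p] (hF : IsSmoothCubic F) {e n : ℕ} (hn : 3 * p ^ e < 2 * n)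
    {G : MvPolynomial (Fin 3) k} (hG : G.IsHomogeneous n) :
    G ∈ Ideal.span {F} ⊔ frobeniusPower k (p ^ e) := by
  set q := p ^ e with hq
  set J := Ideal.span {F} ⊔ frobeniusPower k q with hJ
  by_contra hGJ
  obtain ⟨l, hlG, hlJ⟩ := Submodule.exists_le_ker_of_notMem (p := J.restrictScalars k) hGJ
  have hl : ∀ H ∈ J, l H = 0 := fun H hH => hlJ hH
  have hmon : ∀ α : Fin 3 →₀ ℕ, (∃ i, q ≤ α i) → l (monomial α 1) = 0 := fun α hα =>
    hl _ (Ideal.mem_sup_right (mem_frobeniusPower.2 fun β hβ => by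
      rw [coeff_monomial] at hβ
      split_ifs at hβ with h
      · rwa [← h]
      · exact absurd rfl hβ))
  have hq0 : 0 < q := pow_pos (Fact.out : p.Prime).pos e
  have hdeg : ∀ {α : Fin 3 →₀ ℕ} {H : MvPolynomial (Fin 3) k} {m : ℕ}, H.IsHomogeneous m →
      coeff α H ≠ 0 → α 0 + α 1 + α 2 = m := fun {α H m} hH hα => by
    rw [← hH hα, ← Fin.sum_univ_three α, ← Finsupp.degree_eq_sum]
    exact DFunLike.congr_fun Finsupp.degree_eq_weight_one α
  obtain ⟨top, htop⟩ : ∃ top : Fin 3 →₀ ℕ, ∀ i, top i = q - 1 :=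
    ⟨Finsupp.equivFunOnFinite.symm fun _ => q - 1, fun _ => rfl⟩
  have hbox : ∀ α : Fin 3 →₀ ℕ, ¬ α ≤ top → l (monomial α 1) = 0 := fun α hα => by
    obtain ⟨i, hi⟩ : ∃ i, ¬ α i ≤ top i := by simpa [Finsupp.le_def] using hα
    exact hmon α ⟨i, by rw [htop] at hi; omega⟩
  have hmul : ∀ (α : Fin 3 →₀ ℕ) (c : k), monomial α c = c • monomial α 1 := fun α c => by
    rw [smul_monomial, smul_eq_mul, mul_one]
  have hvanish : ∀ α : Fin 3 →₀ ℕ, α ≤ top → α 0 + α 1 + α 2 = n → l (monomial α 1) = 0 := by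
    intro α hα hαn
    have hα' := fun i => hα i
    simp only [htop] at hα'
    obtain ⟨d, hd⟩ : ∃ d, d + n = 3 * (q - 1) :=
      ⟨3 * (q - 1) - n, by have := hα' 0; have := hα' 1; have := hα' 2; omega⟩
    let s := (Finset.Iic top).filter fun δ => δ 0 + δ 1 + δ 2 = d
    let g : MvPolynomial (Fin 3) k := ∑ δ ∈ s, monomial δ (l (monomial (top - δ) 1))
    have hs : ∀ δ, δ ∈ s ↔ δ ≤ top ∧ δ 0 + δ 1 + δ 2 = d := fun δ => by simp [s]
    have hcoeff : ∀ δ, coeff δ g = if δ ∈ s then l (monomial (top - δ) 1) else 0 := fun δ => by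
      simp [g, coeff_sum, coeff_monomial]
    have hg : g.IsHomogeneous d := IsHomogeneous.sum _ _ _ fun δ hδ =>
      isHomogeneous_monomial _ (by
        rw [Finsupp.degree_eq_sum, Fin.sum_univ_three]
        exact ((hs δ).1 hδ).2)
    have hFg : F * g ∈ frobeniusPower k q := mem_frobeniusPower.2 fun γ hγ => by
      by_contra! hlt
      have hγd := hdeg (hF.isHomogeneous.mul hg) hγ
      have hγt : γ ≤ top := fun i => by rw [htop]; have := hlt i; omega
      refine hγ ((Eq.trans ?_ (hl (F * monomial (top - γ) 1)
        (Ideal.mem_sup_left (Ideal.mul_mem_right _ _ (Ideal.mem_span_singleton_self F))))))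
      conv_lhs => rw [F.as_sum]
      conv_rhs => rw [F.as_sum]
      rw [Finset.sum_mul, Finset.sum_mul, coeff_sum, map_sum]
      refine Finset.sum_congr rfl fun a ha => ?_
      have had := hdeg hF.isHomogeneous (mem_support_iff.1 ha)
      rw [coeff_monomial_mul', monomial_mul, mul_one, hmul, map_smul, smul_eq_mul]
      split_ifs with haγ
      · have h1 := fun i => haγ i
        have h2 := fun i => hγt i
        have hmem : γ - a ∈ s := (hs _).2 ⟨fun i => by
          have := h2 i
          rw [Finsupp.tsub_apply]; omega, by
          have := h1 0; have := h1 1; have := h1 2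
          simp only [Finsupp.tsub_apply]; omega⟩
        rw [hcoeff, if_pos hmem]
        congr 4
        ext i
        have := h1 i
        have := h2 i
        simp only [Finsupp.tsub_apply, Finsupp.add_apply]
        omega
      · rw [hbox, mul_zero]
        refine fun h => haγ fun i => ?_
        have h1 := h i
        have h2 := hγt i
        simp only [Finsupp.tsub_apply, Finsupp.add_apply] at h1
        omega
    have hgI := hF.mem_frobeniusPower_of_mul_mem (e := e) (by omega) hg hFg
    have hδ : top - α ∈ s := (hs _).2 ⟨tsub_le_self, by
      have := hα' 0; have := hα' 1; have := hα' 2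
      simp only [Finsupp.tsub_apply, htop]; omega⟩
    by_contra hne
    obtain ⟨i, hi⟩ := mem_frobeniusPower.1 hgI (top - α) (by
      rwa [hcoeff, if_pos hδ, tsub_tsub_cancel_of_le hα])
    rw [Finsupp.tsub_apply, htop] at hi
    omega
  refine hlG ?_
  rw [G.as_sum, map_sum]
  refine Finset.sum_eq_zero fun α hα => ?_
  rw [hmul, map_smul, smul_eq_mul]
  by_cases hαt : α ≤ top
  · rw [hvanish α hαt (hdeg hG (mem_support_iff.1 hα)), mul_zero]
  · rw [hbox α hαt, mul_zero]

/-- The space of forms of degree `n` in an ideal. -/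
noncomputable def gradedPart (J : Ideal (MvPolynomial (Fin 3) k)) (n : ℕ) :
    Submodule k (MvPolynomial (Fin 3) k) :=
  J.restrictScalars k ⊓ homogeneousSubmodule (Fin 3) k n

theorem mem_gradedPart {J : Ideal (MvPolynomial (Fin 3) k)} {n : ℕ} {G : MvPolynomial (Fin 3) k} :
    G ∈ gradedPart J n ↔ G ∈ J ∧ G.IsHomogeneous n := Iff.rfl

instance finite_gradedPart (J : Ideal (MvPolynomial (Fin 3) k)) (n : ℕ) :
    Module.Finite k (gradedPart J n) :=
  Submodule.finiteDimensional_inf_right _ _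

theorem finrank_quotient_add_sum_finrank_gradedPart {J : Ideal (MvPolynomial (Fin 3) k)} {N : ℕ}
    (hJ : ∀ G ∈ J, ∀ n, homogeneousComponent n G ∈ J)
    (hN : ∀ n, N ≤ n → ∀ G : MvPolynomial (Fin 3) k, G.IsHomogeneous n → G ∈ J) :
    Module.finrank k (MvPolynomial (Fin 3) k ⧸ J) +
        ∑ n ∈ Finset.range N, Module.finrank k (gradedPart J n) =
      ∑ n ∈ Finset.range N, (n + 2).choose 2 := by
  let S := fun n : Fin N => homogeneousSubmodule (Fin 3) k n
  let P := fun n : Fin N => (J.restrictScalars k).comap (S n).subtype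
  let L : (∀ n, S n) →ₗ[k] MvPolynomial (Fin 3) k ⧸ J :=
    (J.mkQ.restrictScalars k) ∘ₗ ∑ n, (S n).subtype ∘ₗ LinearMap.proj n
  have hL : ∀ v, L v = Ideal.Quotient.mk J (∑ n, (v n : MvPolynomial (Fin 3) k)) := fun v => by
    simp [L]
  have hker : LinearMap.ker L = Submodule.pi Set.univ P := by
    ext v
    rw [LinearMap.mem_ker, hL, Ideal.Quotient.eq_zero_iff_mem]
    refine ⟨fun h n _ => ?_, fun h => sum_mem fun n _ => h n trivial⟩
    have := hJ _ h n
    rw [map_sum, Finset.sum_eq_single n] at this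
    · rwa [homogeneousComponent_of_mem (v n).2, if_pos rfl] at this
    · intro m _ hm
      rw [homogeneousComponent_of_mem (v m).2, if_neg fun h => hm (Fin.ext h.symm)]
    · simp
  have hsurj : Function.Surjective L := by
    intro y
    obtain ⟨G, rfl⟩ := Ideal.Quotient.mk_surjective y
    rw [← LinearMap.mem_range, ← sum_homogeneousComponent G, map_sum]
    refine sum_mem fun n _ => ?_
    by_cases hn : n < N
    · refine ⟨Pi.single ⟨n, hn⟩ ⟨_, homogeneousComponent_isHomogeneous n G⟩, ?_⟩
      rw [hL, Finset.sum_eq_single ⟨n, hn⟩]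
      · rw [Pi.single_eq_same]
      · intro m _ hm
        rw [Pi.single_eq_of_ne hm]
        rfl
      · simp
    · rw [Ideal.Quotient.eq_zero_iff_mem.2
        (hN n (not_lt.1 hn) _ (homogeneousComponent_isHomogeneous n G))]
      exact zero_mem _
  have hfree : ∀ n, Module.Free k (S n ⧸ P n) := fun n => Module.Free.of_divisionRing _ _
  have h1 : Module.finrank k (MvPolynomial (Fin 3) k ⧸ J) =
      ∑ n, Module.finrank k (S n ⧸ P n) := by
    rw [← (L.quotKerEquivOfSurjective hsurj).finrank_eq,
      (Submodule.quotEquivOfEq _ _ hker).finrank_eq, (Submodule.quotientPi P).finrank_eq,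
      Module.finrank_pi_fintype]
  have h2 : ∀ n : Fin N,
      Module.finrank k (gradedPart J n) = Module.finrank k (P n) := fun n => by
    rw [gradedPart, inf_comm, ← Submodule.map_comap_subtype, Submodule.finrank_map_subtype_eq]
  rw [h1, ← Fin.sum_univ_eq_sum_range, ← Fin.sum_univ_eq_sum_range, ← Finset.sum_add_distrib]
  refine Finset.sum_congr rfl fun n _ => ?_
  rw [← finrank_homogeneousSubmodule (k := k), ← Submodule.finrank_quotient_add_finrank (P n),
    h2]

theorem finrank_map_mul_left {A : Submodule k (MvPolynomial (Fin 3) k)} (hF : F ≠ 0) :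
    Module.finrank k (A.map (LinearMap.mulLeft k F)) = Module.finrank k A :=
  (A.equivMapOfInjective _ (mul_right_injective₀ hF)).finrank_eq.symm

variable (k) in
theorem finrank_gradedPart_frobeniusPower {m : ℕ} (hm : m < q) :
    Module.finrank k (gradedPart (frobeniusPower k q) (q + m)) = 3 * (m + 2).choose 2 := by
  let L : (Fin 3 → homogeneousSubmodule (Fin 3) k m) →ₗ[k] MvPolynomial (Fin 3) k :=
    ∑ i, LinearMap.mulRight k (X i ^ q) ∘ₗ
      (homogeneousSubmodule (Fin 3) k m).subtype ∘ₗ LinearMap.proj i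
  have hL : ∀ v, L v = ∑ i, (v i : MvPolynomial (Fin 3) k) * X i ^ q := fun v => by simp [L]
  have hX : ∀ i, (X i ^ q : MvPolynomial (Fin 3) k).IsHomogeneous q := fun i => by
    simpa using (isHomogeneous_X k i).pow q
  have hrange : LinearMap.range L = gradedPart (frobeniusPower k q) (q + m) := by
    ext G
    constructor
    · rintro ⟨v, rfl⟩
      rw [hL]
      exact ⟨Ideal.mem_span_range_iff_exists_fun.2 ⟨_, rfl⟩,
        IsHomogeneous.sum _ _ _ fun i _ => add_comm m q ▸ (v i).2.mul (hX i)⟩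
    · intro hG
      rw [mem_gradedPart] at hG
      rcases exists_isHomogeneous_sum_mul_X_pow hG.2 hG.1 with rfl | ⟨m', a, hm', ha, hs⟩
      · exact zero_mem _
      · obtain rfl : m' = m := by omega
        exact ⟨fun i => ⟨a i, ha i⟩, by rw [hL, ← hs]⟩
  have hinj : Function.Injective L := by
    rw [← LinearMap.ker_eq_bot, LinearMap.ker_eq_bot']
    intro v hv
    ext i α
    rw [hL] at hv
    have := congrArg (coeff (α + Finsupp.single i q)) hv
    rw [coeff_sum, Finset.sum_eq_single i] at this
    · rw [X_pow_eq_monomial, coeff_mul_monomial, mul_one] at this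
      simpa using this
    · intro j _ hj
      rw [X_pow_eq_monomial, coeff_mul_monomial', mul_one]
      split_ifs with h
      · by_contra hne
        have hle := Finsupp.le_degree i (α + Finsupp.single i q - Finsupp.single j q)
        have hdeg := (DFunLike.congr_fun Finsupp.degree_eq_weight_one _).trans ((v j).2 hne)
        simp [hdeg, Finsupp.single_eq_of_ne hj.symm] at hle
        omega
      · rfl
    · simp
  rw [← hrange, LinearMap.finrank_range_of_inj hinj, Module.finrank_pi_fintype]
  simp [finrank_homogeneousSubmodule]

theorem span_insert_X_pow_eq (F : MvPolynomial (Fin 3) k) (q : ℕ) :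
    Ideal.span {F, X 0 ^ q, X 1 ^ q, X 2 ^ q} = Ideal.span {F} ⊔ frobeniusPower k q := by
  rw [Ideal.span_insert, frobeniusPower]
  congr 2
  ext G
  simp [Fin.exists_fin_succ, eq_comm]

theorem exists_eq_mul_add_of_mem_span_sup {J : Ideal (MvPolynomial (Fin 3) k)}
    {G : MvPolynomial (Fin 3) k} (hG : G ∈ Ideal.span {F} ⊔ J) : ∃ a, ∃ b ∈ J, F * a + b = G := by
  obtain ⟨x, hx, b, hb, rfl⟩ := Submodule.mem_sup.1 hG
  obtain ⟨a, rfl⟩ := Ideal.mem_span_singleton'.1 hx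
  exact ⟨a, b, hb, by rw [mul_comm]⟩

theorem homogeneousComponent_mem_span_sup_frobeniusPower (hF : F.IsHomogeneous 3)
    {G : MvPolynomial (Fin 3) k} (hG : G ∈ Ideal.span {F} ⊔ frobeniusPower k q) (n : ℕ) :
    homogeneousComponent n G ∈ Ideal.span {F} ⊔ frobeniusPower k q := by
  obtain ⟨a, b, hb, rfl⟩ := exists_eq_mul_add_of_mem_span_sup hG
  rw [map_add]
  refine add_mem (Ideal.mem_sup_left ?_)
    (Ideal.mem_sup_right (homogeneousComponent_mem_frobeniusPower hb n))
  rcases lt_or_ge n 3 with hn | hn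
  · rw [homogeneousComponent_mul_eq_zero_of_lt hF hn]
    exact zero_mem _
  · obtain ⟨m, rfl⟩ := Nat.exists_eq_add_of_le hn
    rw [homogeneousComponent_mul_of_isHomogeneous hF]
    exact Ideal.mul_mem_right _ _ (Ideal.mem_span_singleton_self F)

theorem gradedPart_span_sup_of_lt (hF : F.IsHomogeneous 3) {n : ℕ} (hn : n < 3) :
    gradedPart (Ideal.span {F} ⊔ frobeniusPower k q) n = gradedPart (frobeniusPower k q) n := by
  refine le_antisymm (fun G hG => ?_) (inf_le_inf_right _ fun G hG => Ideal.mem_sup_right hG)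
  obtain ⟨hGJ, hGn⟩ := mem_gradedPart.1 hG
  obtain ⟨a, b, hb, rfl⟩ := exists_eq_mul_add_of_mem_span_sup hGJ
  refine mem_gradedPart.2 ⟨?_, hGn⟩
  have := homogeneousComponent_of_mem (m := n) hGn
  rw [if_pos rfl, map_add, homogeneousComponent_mul_eq_zero_of_lt hF hn, zero_add] at this
  rw [← this]
  exact homogeneousComponent_mem_frobeniusPower hb n

theorem gradedPart_span_sup_add (hF : F.IsHomogeneous 3) (n : ℕ) :
    gradedPart (Ideal.span {F} ⊔ frobeniusPower k q) (3 + n) =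
      (homogeneousSubmodule (Fin 3) k n).map (LinearMap.mulLeft k F) ⊔
        gradedPart (frobeniusPower k q) (3 + n) := by
  refine le_antisymm (fun G hG => ?_) (sup_le ?_ ?_)
  · obtain ⟨hGJ, hGn⟩ := mem_gradedPart.1 hG
    obtain ⟨a, b, hb, rfl⟩ := exists_eq_mul_add_of_mem_span_sup hGJ
    have := homogeneousComponent_of_mem (m := 3 + n) hGn
    rw [if_pos rfl, map_add, homogeneousComponent_mul_of_isHomogeneous hF] at this
    rw [← this]
    exact Submodule.add_mem_sup
      (Submodule.mem_map_of_mem (f := LinearMap.mulLeft k F)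
        (homogeneousComponent_isHomogeneous n a))
      ⟨homogeneousComponent_mem_frobeniusPower hb _, homogeneousComponent_isHomogeneous _ _⟩
  · rintro _ ⟨a, ha, rfl⟩
    exact ⟨Ideal.mem_sup_left (Ideal.mul_mem_right _ _ (Ideal.mem_span_singleton_self F)),
      hF.mul ha⟩
  · exact inf_le_inf_right _ fun G hG => Ideal.mem_sup_right hG

theorem IsSmoothCubic.choose_le_finrank_gradedPart (hF : IsSmoothCubic F) (n : ℕ) :
    (n + 2).choose 2 ≤
      Module.finrank k (gradedPart (Ideal.span {F} ⊔ frobeniusPower k q) (3 + n)) := by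
  rw [← finrank_homogeneousSubmodule (k := k), ← finrank_map_mul_left hF.ne_zero,
    gradedPart_span_sup_add hF.isHomogeneous]
  exact Submodule.finrank_mono le_sup_left

theorem finrank_gradedPart_le (J : Ideal (MvPolynomial (Fin 3) k)) (n : ℕ) :
    Module.finrank k (gradedPart J n) ≤ (n + 2).choose 2 := by
  rw [← finrank_homogeneousSubmodule (k := k)]
  exact Submodule.finrank_mono inf_le_right

theorem IsSmoothCubic.finrank_gradedPart_add [IsAlgClosed k] {p : ℕ} [Fact p.Prime]
    [CharP k p] (hF : IsSmoothCubic F) {e n : ℕ} (hn : 2 * (3 + n) < 3 * p ^ e) :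
    Module.finrank k (gradedPart (Ideal.span {F} ⊔ frobeniusPower k (p ^ e)) (3 + n)) +
        Module.finrank k (gradedPart (frobeniusPower k (p ^ e)) n) =
      (n + 2).choose 2 + Module.finrank k (gradedPart (frobeniusPower k (p ^ e)) (3 + n)) := by
  have hinf : (homogeneousSubmodule (Fin 3) k n).map (LinearMap.mulLeft k F) ⊓
        gradedPart (frobeniusPower k (p ^ e)) (3 + n) =
      (gradedPart (frobeniusPower k (p ^ e)) n).map (LinearMap.mulLeft k F) := by
    ext G
    constructor
    · rintro ⟨⟨g, hg, rfl⟩, h, _⟩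
      exact ⟨g, ⟨hF.mem_frobeniusPower_of_mul_mem hn hg h, hg⟩, rfl⟩
    · rintro ⟨g, ⟨hgI, hg⟩, rfl⟩
      exact ⟨⟨g, hg, rfl⟩, Ideal.mul_mem_left _ _ hgI, hF.isHomogeneous.mul hg⟩
  have := Submodule.finrank_sup_add_finrank_inf_eq
    ((homogeneousSubmodule (Fin 3) k n).map (LinearMap.mulLeft k F))
    (gradedPart (frobeniusPower k (p ^ e)) (3 + n))
  rwa [hinf, ← gradedPart_span_sup_add hF.isHomogeneous, finrank_map_mul_left hF.ne_zero,
    finrank_map_mul_left hF.ne_zero, finrank_homogeneousSubmodule] at this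

theorem IsSmoothCubic.sum_finrank_gradedPart [IsAlgClosed k] {p : ℕ} [Fact p.Prime]
    [CharP k p] (hF : IsSmoothCubic F) {e t : ℕ} (ht : 2 * (2 + t) < 3 * p ^ e) :
    ∑ n ∈ Finset.range (3 + t),
        Module.finrank k (gradedPart (Ideal.span {F} ⊔ frobeniusPower k (p ^ e)) n) +
      ∑ n ∈ Finset.range t, Module.finrank k (gradedPart (frobeniusPower k (p ^ e)) n) =
    ∑ n ∈ Finset.range t, (n + 2).choose 2 +
      ∑ n ∈ Finset.range (3 + t), Module.finrank k (gradedPart (frobeniusPower k (p ^ e)) n) := by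
  induction t with
  | zero =>
    simp only [Finset.range_zero, Finset.sum_empty, add_zero, zero_add]
    exact Finset.sum_congr rfl fun n hn => by
      rw [gradedPart_span_sup_of_lt hF.isHomogeneous (Finset.mem_range.1 hn)]
  | succ t ih =>
    have h1 := ih (by omega)
    have h2 := hF.finrank_gradedPart_add (e := e) (n := t) (by omega)
    rw [← add_assoc, Finset.sum_range_succ _ (3 + t), Finset.sum_range_succ _ (3 + t),
      Finset.sum_range_succ _ t, Finset.sum_range_succ _ t]
    omega

/-- Two-sided bounds on the Hilbert–Kunz function; the two sides differ by a term linear in `q`. -/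
theorem IsSmoothCubic.finrank_quotient_bounds [IsAlgClosed k] {p : ℕ} [Fact p.Prime]
    [CharP k p] (hF : IsSmoothCubic F) {e m : ℕ} (hm : m + 3 = (p ^ e + 1) / 2) :
    ∑ j ∈ Finset.range 3, (p ^ e + m + j + 2).choose 2 ≤
      Module.finrank k (MvPolynomial (Fin 3) k ⧸ (Ideal.span {F} ⊔ frobeniusPower k (p ^ e))) +
        3 * ∑ j ∈ Finset.range 3, (m + j + 2).choose 2 ∧
    Module.finrank k (MvPolynomial (Fin 3) k ⧸ (Ideal.span {F} ⊔ frobeniusPower k (p ^ e))) +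
        3 * ∑ j ∈ Finset.range 3, (m + j + 2).choose 2 ≤
      ∑ j ∈ Finset.range 3, (p ^ e + m + j + 3).choose 2 := by
  set q := p ^ e with hq
  have hsum := hF.sum_finrank_gradedPart (e := e) (t := q + m) (by omega)
  have htot := finrank_quotient_add_sum_finrank_gradedPart (N := 3 + (q + m) + 1)
    (fun G hG n => homogeneousComponent_mem_span_sup_frobeniusPower (q := q) hF.isHomogeneous hG n)
    (fun n hn G hG => hF.mem_span_sup_frobeniusPower (by omega) hG)
  have hlow := hF.choose_le_finrank_gradedPart (q := q) (q + m)
  have hupp := finrank_gradedPart_le (Ideal.span {F} ⊔ frobeniusPower k q) (3 + (q + m))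
  have hI : ∀ j < 3, Module.finrank k (gradedPart (frobeniusPower k q) (q + m + j)) =
      3 * (m + j + 2).choose 2 := fun j hj => by
    rw [add_assoc, finrank_gradedPart_frobeniusPower k (by omega)]
  rw [← hq] at hsum
  rw [add_comm 3 (q + m)] at hsum htot hlow hupp
  simp only [Finset.sum_range_succ _ (q + m + 3), Finset.sum_range_succ _ (q + m + 2),
    Finset.sum_range_succ _ (q + m + 1), Finset.sum_range_succ _ (q + m)] at hsum htot
  have h0 : _ = 3 * (m + 2).choose 2 :=
    finrank_gradedPart_frobeniusPower k (q := q) (m := m) (by omega)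
  have h1 := hI 1 (by norm_num)
  have h2 := hI 2 (by norm_num)
  simp only [Finset.sum_range_succ, Finset.sum_range_zero, zero_add]
  simp only [add_zero, add_assoc, Nat.reduceAdd] at hsum htot hlow hupp h0 h1 h2 ⊢
  constructor <;> omega

end

theorem tendsto_div_sq_of_abs_sub_le {φ q : ℕ → ℝ} {c C : ℝ} (hq : Tendsto q atTop atTop)
    (h : ∀ᶠ e in atTop, |φ e - c * q e ^ 2| ≤ C * q e) :
    Tendsto (fun e => φ e / q e ^ 2) atTop (nhds c) := by
  rw [tendsto_iff_norm_sub_tendsto_zero]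
  have hlim : Tendsto (fun e => C * (q e)⁻¹) atTop (nhds 0) := by
    simpa using hq.inv_tendsto_atTop.const_mul C
  refine squeeze_zero' (Eventually.of_forall fun e => norm_nonneg _) ?_ hlim
  filter_upwards [h, hq.eventually_gt_atTop 0] with e he hpos
  rw [Real.norm_eq_abs, div_sub' (by positivity), abs_div, abs_of_pos (by positivity : 0 < q e ^ 2),
    div_le_iff₀ (by positivity), mul_comm (q e ^ 2)]
  refine he.trans_eq ?_
  field_simp

theorem IsSmoothCubic.abs_finrank_sub_le {k : Type u} [Field k] [IsAlgClosed k] {p : ℕ}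
    [Fact p.Prime] [CharP k p] {F : MvPolynomial (Fin 3) k} (hF : IsSmoothCubic F) {e : ℕ}
    (he : 5 ≤ p ^ e) :
    |(Module.finrank k (MvPolynomial (Fin 3) k ⧸
        (Ideal.span {F} ⊔ frobeniusPower k (p ^ e))) : ℝ) - 9 / 4 * ((p ^ e : ℕ) : ℝ) ^ 2| ≤
      20 * ((p ^ e : ℕ) : ℝ) := by
  obtain ⟨m, hm⟩ : ∃ m, m + 3 = (p ^ e + 1) / 2 := ⟨(p ^ e + 1) / 2 - 3, by omega⟩
  obtain ⟨h1, h2⟩ := hF.finrank_quotient_bounds hm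
  rw [← Nat.cast_le (α := ℝ)] at h1 h2
  generalize (Module.finrank k (MvPolynomial (Fin 3) k ⧸
        (Ideal.span {F} ⊔ frobeniusPower k (p ^ e)))) = φ at *
  generalize p ^ e = q at *
  simp only [Finset.sum_range_succ, Finset.sum_range_zero] at h1 h2
  push_cast [Nat.cast_choose_two] at h1 h2
  rw [abs_le]
  have hm0 : (0 : ℝ) ≤ m := Nat.cast_nonneg m
  obtain rfl | rfl : q = 2 * m + 5 ∨ q = 2 * m + 6 := by omega
  all_goals
    push_cast at h1 h2 ⊢
    constructor <;> nlinarith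

/-- The Hilbert–Kunz multiplicity of the irrelevant maximal ideal of the homogeneous
coordinate ring `k[X,Y,Z]/(F)` of a smooth plane cubic over an algebraically closed
field of characteristic `p > 0` equals `9/4`. -/
theorem hilbert_kunz_multiplicity_smooth_plane_cubic
    (k : Type*) [Field k] [IsAlgClosed k] (p : ℕ) (hp : 0 < p) [CharP k p]
    (F : MvPolynomial (Fin 3) k) (hF : F.IsHomogeneous 3)
    (hsmooth : ∀ a : Fin 3 → k,
      eval a F = 0 → (∀ i : Fin 3, eval a (pderiv i F) = 0) → a = 0) :
    Tendsto
      (fun e : ℕ =>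
        (Module.finrank k
            (MvPolynomial (Fin 3) k ⧸
              Ideal.span {F, X 0 ^ p ^ e, X 1 ^ p ^ e, X 2 ^ p ^ e}) : ℝ) /
          (p : ℝ) ^ (2 * e))
      atTop (nhds (9 / 4)) := by
  have hprime : p.Prime := (CharP.char_is_prime_or_zero k p).resolve_right hp.ne'
  have : Fact p.Prime := ⟨hprime⟩
  have hF' : IsSmoothCubic F := ⟨hF, hsmooth⟩
  have hq : Tendsto (fun e => p ^ e) atTop atTop :=
    tendsto_pow_atTop_atTop_of_one_lt hprime.one_lt
  have := tendsto_div_sq_of_abs_sub_le (tendsto_natCast_atTop_atTop.comp hq)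
    ((hq.eventually_ge_atTop 5).mono fun e he => hF'.abs_finrank_sub_le he)
  refine this.congr fun e => ?_
  rw [span_insert_X_pow_eq, Function.comp_apply, Nat.cast_pow, ← pow_mul, mul_comm e]
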